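/- arXiv:1206.1949 — 3 statements merged into one kernel-verified Lean document; each statement's English description precedes it below -/
import Mathlib

section
/- The hyperspace mpcc(ℝ^ω) of all nonempty compact max-plus convex subsets of ℕ → ℝ, topologized by the Hausdorff metric (equivalently, the Vietoris topology), is an absolute retract for metrizable spaces. -/
/-- A subset `A` of a function space `ι → ℝ` is max-plus convex if for all `a, b ∈ A`
and every real `t ≤ 0`, the function `fun i => max (a i) (t + b i)` belongs to `A`. -/
def MaxPlusConvex {ι : Type*} (A : Set (ι → ℝ)) : Prop :=
  ∀ a ∈ A, ∀ b ∈ A, ∀ t : ℝ, t ≤ 0 → (fun i => max (a i) (t + b i)) ∈ A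

/-- The Vietoris topology on a family of subsets of a topological space `X`,
generated by the sets `{K | K ⊆ U}` and `{K | K ∩ U ≠ ∅}` for `U` open in `X`.
On nonempty compact subsets of a metrizable space it coincides with the topology
of the Hausdorff metric. -/
def vietoris {X : Type*} [TopologicalSpace X] (P : Set X → Prop) :
    TopologicalSpace {A : Set X // P A} :=
  TopologicalSpace.generateFrom
    {S | ∃ U : Set X, IsOpen U ∧
      (S = {K : {A : Set X // P A} | (K : Set X) ⊆ U} ∨
        S = {K : {A : Set X // P A} | ((K : Set X) ∩ U).Nonempty})}

/-- The hyperspace of all nonempty compact max-plus convex subsets of `ℕ → ℝ`. -/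
abbrev MPCC := {A : Set (ℕ → ℝ) // A.Nonempty ∧ IsCompact A ∧ MaxPlusConvex A}

/-- `X` is an absolute retract for metrizable spaces: `X` is metrizable and whenever `X`
is embedded as a closed subspace of a metrizable space `Y`, there is a continuous
retraction of `Y` onto the image of `X`. -/
def IsAbsoluteRetract (X : Type*) [TopologicalSpace X] : Prop :=
  TopologicalSpace.MetrizableSpace X ∧
    ∀ (Y : Type*) [TopologicalSpace Y] [TopologicalSpace.MetrizableSpace Y] (e : X → Y),
      Topology.IsClosedEmbedding e → ∃ r : Y → X, Continuous r ∧ ∀ x, r (e x) = x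

open Set Filter Topology Uniformity

/-- A family of nonnegative weights with finite nonempty support. -/
structure IsMaxWeight {ι : Type*} (w : ι → ℝ) : Prop where
  nonneg : ∀ i, 0 ≤ w i
  finite_support : (Function.support w).Finite
  nonempty_support : (Function.support w).Nonempty

/-- The max-plus combination of the reals `x i`, with coefficients the logarithms of the
weights `w i`, normalized to have maximum `0`. -/
noncomputable def maxPlusComb {ι : Type*} (w x : ι → ℝ) : ℝ :=
  Real.log (⨆ i, w i * Real.exp (x i)) - Real.log (⨆ i, w i * Real.exp 0)

theorem ciSup_weight_mul_exp_eq_sup' {ι : Type*} {w : ι → ℝ} (hw : ∀ i, 0 ≤ w i)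
    {s : Finset ι} (hs : s.Nonempty) (hws : Function.support w ⊆ s) (x : ι → ℝ) :
    ⨆ i, w i * Real.exp (x i) = s.sup' hs fun i => w i * Real.exp (x i) := by
  have hle : ∀ i, w i * Real.exp (x i) ≤ s.sup' hs fun i => w i * Real.exp (x i) := by
    intro i
    by_cases hi : i ∈ s
    · exact Finset.le_sup' (fun i => w i * Real.exp (x i)) hi
    · have hwi : w i = 0 := by
        by_contra h
        exact hi (hws h)
      obtain ⟨j, hj⟩ := hs
      have h₁ := Finset.le_sup' (fun i => w i * Real.exp (x i)) hj
      have h₂ : 0 ≤ w j * Real.exp (x j) := mul_nonneg (hw j) (Real.exp_pos _).le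
      simpa [hwi] using h₂.trans h₁
  have : Nonempty ι := ⟨hs.choose⟩
  refine le_antisymm (ciSup_le hle) (Finset.sup'_le _ _ fun i _ => ?_)
  exact le_ciSup (f := fun i => w i * Real.exp (x i)) ⟨_, forall_mem_range.2 hle⟩ i

namespace IsMaxWeight

variable {ι : Type*} {w : ι → ℝ}

theorem exists_log_ciSup_eq (hw : IsMaxWeight w) (x : ι → ℝ) :
    (∀ i, w i ≠ 0 → Real.log (w i) + x i ≤ Real.log (⨆ i, w i * Real.exp (x i))) ∧
      ∃ i, w i ≠ 0 ∧ Real.log (⨆ i, w i * Real.exp (x i)) = Real.log (w i) + x i := by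
  have hne : hw.finite_support.toFinset.Nonempty := by simpa using hw.nonempty_support
  rw [ciSup_weight_mul_exp_eq_sup' hw.nonneg hne (by simp)]
  have hpos : ∀ i, w i ≠ 0 → 0 < w i * Real.exp (x i) := fun i hi =>
    mul_pos (lt_of_le_of_ne (hw.nonneg i) hi.symm) (Real.exp_pos _)
  have hlog : ∀ i, w i ≠ 0 → Real.log (w i * Real.exp (x i)) = Real.log (w i) + x i :=
    fun i hi => by rw [Real.log_mul hi (Real.exp_ne_zero _), Real.log_exp]
  refine ⟨fun i hi => ?_, ?_⟩
  · rw [← hlog i hi]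
    exact Real.log_le_log (hpos i hi)
      (Finset.le_sup' (fun i => w i * Real.exp (x i)) (by simpa using hi))
  · obtain ⟨i, hi, h⟩ := Finset.exists_mem_eq_sup' hne fun i => w i * Real.exp (x i)
    have hi' : w i ≠ 0 := by simpa using hi
    exact ⟨i, hi', by rw [h, hlog i hi']⟩

/-- A max-plus combination is the maximum of finitely many translates. -/
theorem exists_coeff (hw : IsMaxWeight w) :
    ∃ c : ι → ℝ, (∀ i, w i ≠ 0 → c i ≤ 0) ∧ (∃ i, w i ≠ 0 ∧ c i = 0) ∧
      ∀ x, (∀ i, w i ≠ 0 → c i + x i ≤ maxPlusComb w x) ∧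
        ∃ i, w i ≠ 0 ∧ maxPlusComb w x = c i + x i := by
  have h₀ := hw.exists_log_ciSup_eq fun _ => 0
  refine ⟨fun i => Real.log (w i) - Real.log (⨆ i, w i * Real.exp 0), fun i hi => ?_, ?_,
    fun x => ⟨fun i hi => ?_, ?_⟩⟩
  · linarith [h₀.1 i hi]
  · obtain ⟨i, hi, h⟩ := h₀.2
    exact ⟨i, hi, by linarith⟩
  · have := (hw.exists_log_ciSup_eq x).1 i hi
    simp only [maxPlusComb]
    linarith
  · obtain ⟨i, hi, h⟩ := (hw.exists_log_ciSup_eq x).2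
    exact ⟨i, hi, by simp only [maxPlusComb]; linarith⟩

theorem maxPlusComb_const (hw : IsMaxWeight w) (a : ℝ) : maxPlusComb w (fun _ => a) = a := by
  obtain ⟨c, hc, ⟨j, hj, hcj⟩, h⟩ := hw.exists_coeff
  obtain ⟨hle, i, hi, hi'⟩ := h fun _ => a
  have := hle j hj
  have := hc i hi
  linarith

theorem maxPlusComb_lt_add (hw : IsMaxWeight w) {x y : ι → ℝ} {ε : ℝ}
    (h : ∀ i, w i ≠ 0 → x i < y i + ε) : maxPlusComb w x < maxPlusComb w y + ε := by
  obtain ⟨c, -, -, hc⟩ := hw.exists_coeff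
  obtain ⟨i, hi, hxi⟩ := (hc x).2
  linarith [(hc y).1 i hi, h i hi]

theorem abs_maxPlusComb_sub_lt (hw : IsMaxWeight w) {x y : ι → ℝ} {ε : ℝ}
    (h : ∀ i, w i ≠ 0 → |x i - y i| < ε) : |maxPlusComb w x - maxPlusComb w y| < ε := by
  have h₁ := hw.maxPlusComb_lt_add (x := x) (y := y) (ε := ε) fun i hi => by
    linarith [(abs_lt.1 (h i hi)).2]
  have h₂ := hw.maxPlusComb_lt_add (x := y) (y := x) (ε := ε) fun i hi => by
    linarith [(abs_lt.1 (h i hi)).1]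
  exact abs_lt.2 ⟨by linarith, by linarith⟩

theorem maxPlusComb_max (hw : IsMaxWeight w) (x y : ι → ℝ) (t : ℝ) :
    maxPlusComb w (fun i => max (x i) (t + y i)) =
      max (maxPlusComb w x) (t + maxPlusComb w y) := by
  obtain ⟨c, -, -, hc⟩ := hw.exists_coeff
  obtain ⟨hz, k, hk, hzk⟩ := hc fun i => max (x i) (t + y i)
  obtain ⟨hx, i, hi, hxi⟩ := hc x
  obtain ⟨hy, j, hj, hyj⟩ := hc y
  apply le_antisymm
  · rw [hzk]
    rcases max_cases (x k) (t + y k) with ⟨h, -⟩ | ⟨h, -⟩ <;> rw [h]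
    · exact le_max_of_le_left (hx k hk)
    · exact le_max_of_le_right (by linarith [hy k hk])
  · refine max_le ?_ ?_
    · linarith [hz i hi, le_max_left (x i) (t + y i)]
    · linarith [hz j hj, le_max_right (x j) (t + y j)]

end IsMaxWeight

theorem MaxPlusConvex.exists_finset_max {κ ι : Type*} {A : Set (κ → ℝ)} (hA : MaxPlusConvex A)
    (c : ι → ℝ) (x : ι → κ → ℝ) {a : κ → ℝ} (ha : a ∈ A) (s : Finset ι)
    (hc : ∀ i ∈ s, c i ≤ 0) (hx : ∀ i ∈ s, x i ∈ A) :
    ∃ z ∈ A, ∀ n, a n ≤ z n ∧ (∀ i ∈ s, c i + x i n ≤ z n) ∧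
      (z n = a n ∨ ∃ i ∈ s, z n = c i + x i n) := by
  classical
  induction s using Finset.induction_on with
  | empty => exact ⟨a, ha, fun n => by simp⟩
  | insert j s _ ih =>
    obtain ⟨z, hz, h⟩ := ih (fun i hi => hc i (Finset.mem_insert_of_mem hi))
      fun i hi => hx i (Finset.mem_insert_of_mem hi)
    refine ⟨_, hA z hz (x j) (hx j (Finset.mem_insert_self _ _)) (c j)
      (hc j (Finset.mem_insert_self _ _)), fun n => ⟨?_, ?_, ?_⟩⟩
    · exact le_max_of_le_left (h n).1
    · intro i hi
      rcases Finset.mem_insert.1 hi with rfl | hi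
      · exact le_max_right _ _
      · exact le_max_of_le_left ((h n).2.1 i hi)
    · rcases max_cases (z n) (c j + x j n) with ⟨h', -⟩ | ⟨h', -⟩ <;> simp only [h']
      · rcases (h n).2.2 with h'' | ⟨i, hi, h''⟩
        · exact Or.inl h''
        · exact Or.inr ⟨i, Finset.mem_insert_of_mem hi, h''⟩
      · exact Or.inr ⟨j, Finset.mem_insert_self _ _, rfl⟩

theorem MaxPlusConvex.maxPlusComb_mem {κ ι : Type*} {A : Set (κ → ℝ)} (hA : MaxPlusConvex A)
    {w : ι → ℝ} (hw : IsMaxWeight w) {x : ι → κ → ℝ} (hx : ∀ i, w i ≠ 0 → x i ∈ A) :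
    (fun n => maxPlusComb w fun i => x i n) ∈ A := by
  obtain ⟨c, hc, ⟨j, hj, hcj⟩, h⟩ := hw.exists_coeff
  obtain ⟨z, hz, hz'⟩ := hA.exists_finset_max c x (hx j hj) hw.finite_support.toFinset
    (fun i hi => hc i (by simpa using hi)) fun i hi => hx i (by simpa using hi)
  convert hz using 1
  funext n
  obtain ⟨hle, i, hi, hi'⟩ := h fun i => x i n
  obtain ⟨-, hzle, hzeq⟩ := hz' n
  apply le_antisymm
  · rw [hi']
    exact hzle i (by simpa using hi)
  · rcases hzeq with h' | ⟨k, hk, h'⟩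
    · linarith [hle j hj]
    · rw [h']
      exact hle k (by simpa using hk)

theorem continuous_maxPlusComb {Z ι : Type*} [TopologicalSpace Z] {W : Z → ι → ℝ}
    (hW : ∀ z, IsMaxWeight (W z)) (hcont : ∀ i, Continuous fun z => W z i)
    (hfin : ∀ z₀, ∃ s : Finset ι, ∀ᶠ z in 𝓝 z₀, Function.support (W z) ⊆ s) :
    Continuous fun p : Z × (ι → ℝ) => maxPlusComb (W p.1) p.2 := by
  have key : ∀ g : Z × (ι → ℝ) → ι → ℝ, Continuous g →
      Continuous fun p => Real.log (⨆ i, W p.1 i * Real.exp (g p i)) := by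
    intro g hg
    refine continuous_iff_continuousAt.2 fun p => ?_
    obtain ⟨s, hs⟩ := hfin p.1
    have hne : s.Nonempty := by
      obtain ⟨i, hi⟩ := (hW p.1).nonempty_support
      exact ⟨i, hs.self_of_nhds hi⟩
    have heq : (fun q : Z × (ι → ℝ) => ⨆ i, W q.1 i * Real.exp (g q i)) =ᶠ[𝓝 p]
        fun q => s.sup' hne fun i => W q.1 i * Real.exp (g q i) := by
      filter_upwards [continuous_fst.continuousAt.eventually hs] with q hq
      exact ciSup_weight_mul_exp_eq_sup' (hW q.1).nonneg hne hq _
    refine ContinuousAt.log ?_ ?_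
    · refine ContinuousAt.congr ?_ heq.symm
      refine ContinuousAt.finset_sup'_apply hne fun i _ => Continuous.continuousAt ?_
      exact ((hcont i).comp continuous_fst).mul
        (Real.continuous_exp.comp ((continuous_apply i).comp hg))
    · refine ne_of_eq_of_ne heq.self_of_nhds ?_
      obtain ⟨i, hi⟩ := (hW p.1).nonempty_support
      refine ne_of_gt (lt_of_lt_of_le ?_ (Finset.le_sup' _ (hs.self_of_nhds hi)))
      exact mul_pos (lt_of_le_of_ne ((hW p.1).nonneg i) (Ne.symm hi)) (Real.exp_pos _)
  exact (key (fun p => p.2) continuous_snd).sub (key (fun _ _ => 0) continuous_const)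

theorem continuous_maxPlusComb_pi {Z ι κ : Type*} [TopologicalSpace Z] {W : Z → ι → ℝ}
    (hW : ∀ z, IsMaxWeight (W z)) (hcont : ∀ i, Continuous fun z => W z i)
    (hfin : ∀ z₀, ∃ s : Finset ι, ∀ᶠ z in 𝓝 z₀, Function.support (W z) ⊆ s) :
    Continuous fun p : Z × (ι → κ → ℝ) => fun n => maxPlusComb (W p.1) fun i => p.2 i n := by
  refine continuous_pi fun n => ?_
  have hg : Continuous fun p : Z × (ι → κ → ℝ) => (p.1, fun i => p.2 i n) := by fun_prop
  exact (continuous_maxPlusComb hW hcont hfin).comp hg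

/-- The max-plus combination of a family of compact max-plus convex sets. -/
noncomputable def MPCC.comb {ι : Type*} (w : ι → ℝ) (hw : IsMaxWeight w) (K : ι → MPCC) :
    MPCC where
  val := (fun (x : ι → ℕ → ℝ) n => maxPlusComb w fun i => x i n) '' univ.pi fun i => (K i).1
  property := by
    refine ⟨(univ_pi_nonempty_iff.2 fun i => (K i).2.1).image _, ?_, ?_⟩
    · refine (isCompact_univ_pi fun i => (K i).2.2.1).image ?_
      have h := continuous_maxPlusComb_pi (Z := Unit) (κ := ℕ) (fun _ => hw)
        (fun _ => continuous_const) fun _ => ⟨hw.finite_support.toFinset, by simp⟩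
      exact h.comp (continuous_const.prodMk continuous_id : Continuous fun x => ((), x))
    · rintro _ ⟨x, hx, rfl⟩ _ ⟨y, hy, rfl⟩ t ht
      refine ⟨fun i n => max (x i n) (t + y i n), fun i hi => ?_, ?_⟩
      · exact (K i).2.2.2 _ (hx i hi) _ (hy i hi) t ht
      · funext n
        exact hw.maxPlusComb_max _ _ t

/-- A point selection on the support determines a point of the combination. -/
theorem MPCC.exists_mem_comb {ι : Type*} {w : ι → ℝ} (hw : IsMaxWeight w) {K : ι → MPCC}
    {p : (ℕ → ℝ) → Prop} (h : ∀ i, w i ≠ 0 → ∃ x ∈ (K i).1, p x) :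
    ∃ x : ι → ℕ → ℝ, (∀ i, w i ≠ 0 → p (x i)) ∧
      (fun n => maxPlusComb w fun i => x i n) ∈ (MPCC.comb w hw K).1 := by
  have h' : ∀ i, ∃ x ∈ (K i).1, w i ≠ 0 → p x := fun i => by
    by_cases hi : w i = 0
    · obtain ⟨x, hx⟩ := (K i).2.1
      exact ⟨x, hx, fun h => absurd hi h⟩
    · obtain ⟨x, hx, hp⟩ := h i hi
      exact ⟨x, hx, fun _ => hp⟩
  choose x hx hp using h'
  exact ⟨x, hp, x, fun i _ => hx i, rfl⟩

theorem exists_finset_forall_abs_sub_lt_subset {κ : Type*} {V : Set ((κ → ℝ) × (κ → ℝ))}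
    (hV : V ∈ uniformity (κ → ℝ)) :
    ∃ (s : Finset κ) (ε : ℝ), 0 < ε ∧ {p | ∀ n ∈ s, |p.2 n - p.1 n| < ε} ⊆ V := by
  classical
  rw [Pi.uniformity] at hV
  refine Filter.iInf_sets_induct hV ⟨∅, 1, one_pos, subset_univ _⟩ ?_
  rintro n V₁ V₂ ⟨T, hT, hTV⟩ ⟨s, ε, hε, hs⟩
  obtain ⟨δ, hδ, hδT⟩ := Metric.mem_uniformity_dist.1 hT
  refine ⟨insert n s, min δ ε, lt_min hδ hε, fun p hp => ⟨hTV ?_, hs fun k hk => ?_⟩⟩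
  · refine hδT ?_
    rw [dist_comm, Real.dist_eq]
    exact (hp n (Finset.mem_insert_self _ _)).trans_le (min_le_left _ _)
  · exact (hp k (Finset.mem_insert_of_mem hk)).trans_le (min_le_right _ _)

theorem isOpen_forall_abs_sub_lt {κ : Type*} (s : Finset κ) (ε : ℝ) (c : κ → ℝ) :
    IsOpen {x : κ → ℝ | ∀ n ∈ s, |x n - c n| < ε} := by
  have : {x : κ → ℝ | ∀ n ∈ s, |x n - c n| < ε} = ⋂ n ∈ s, {x | |x n - c n| < ε} := by
    ext; simp
  rw [this]
  exact isOpen_biInter_finset fun n _ => isOpen_lt (by fun_prop) continuous_const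

theorem MPCC.exists_isOpen_comb_subset (C : MPCC) {U : Set (ℕ → ℝ)} (hU : IsOpen U)
    (hCU : C.1 ⊆ U) :
    ∃ V ⊆ U, IsOpen V ∧ C.1 ⊆ V ∧ ∀ {ι : Type*} (w : ι → ℝ) (hw : IsMaxWeight w)
      (K : ι → MPCC), (∀ i, w i ≠ 0 → (K i).1 ⊆ V) → (MPCC.comb w hw K).1 ⊆ U := by
  obtain ⟨V, hV, hVU⟩ := (C.2.2.1.nhdsSet_basis_uniformity (𝓤 (ℕ → ℝ)).basis_sets).mem_iff.1
    (hU.mem_nhdsSet.2 hCU)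
  obtain ⟨s, ε, hε, hsV⟩ := exists_finset_forall_abs_sub_lt_subset hV
  have hsub : ⋃ c ∈ C.1, {x : ℕ → ℝ | ∀ n ∈ s, |x n - c n| < ε} ⊆ U := by
    refine Subset.trans (iUnion₂_mono fun c _ x hx => ?_) hVU
    exact hsV (show (c, x) ∈ _ from hx)
  refine ⟨⋃ c ∈ C.1, {x : ℕ → ℝ | ∀ n ∈ s, |x n - c n| < ε}, hsub,
    isOpen_biUnion fun c _ => isOpen_forall_abs_sub_lt s ε c,
    fun c hc => mem_biUnion hc fun n _ => by simpa using hε, ?_⟩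
  rintro ι w hw K hK _ ⟨x, hx, rfl⟩
  have h' : ∀ i, ∃ c ∈ C.1, w i ≠ 0 → ∀ n ∈ s, |x i n - c n| < ε := fun i => by
    by_cases hi : w i = 0
    · obtain ⟨c, hc⟩ := C.2.1
      exact ⟨c, hc, fun h => absurd hi h⟩
    · obtain ⟨c, hc, hxc⟩ := mem_iUnion₂.1 (hK i hi (hx i trivial))
      exact ⟨c, hc, fun _ => hxc⟩
  choose c hc hxc using h'
  refine hsub (mem_biUnion (C.2.2.2.maxPlusComb_mem hw fun i _ => hc i) fun n hn => ?_)
  exact hw.abs_maxPlusComb_sub_lt fun i hi => hxc i hi n hn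

theorem MPCC.exists_isOpen_comb_inter_nonempty {c : ℕ → ℝ} {U : Set (ℕ → ℝ)} (hU : IsOpen U)
    (hcU : c ∈ U) :
    ∃ V ⊆ U, IsOpen V ∧ c ∈ V ∧ ∀ {ι : Type*} (w : ι → ℝ) (hw : IsMaxWeight w)
      (K : ι → MPCC), (∀ i, w i ≠ 0 → ((K i).1 ∩ V).Nonempty) →
        ((MPCC.comb w hw K).1 ∩ U).Nonempty := by
  obtain ⟨V, hV, hVU⟩ := UniformSpace.mem_nhds_iff.1 (hU.mem_nhds hcU)
  obtain ⟨s, ε, hε, hsV⟩ := exists_finset_forall_abs_sub_lt_subset hV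
  have hsub : {x : ℕ → ℝ | ∀ n ∈ s, |x n - c n| < ε} ⊆ U := fun x hx =>
    hVU (hsV (show (c, x) ∈ _ from hx))
  refine ⟨_, hsub, isOpen_forall_abs_sub_lt s ε c, fun n _ => by simpa using hε, ?_⟩
  intro ι w hw K hK
  obtain ⟨x, hx, hmem⟩ := MPCC.exists_mem_comb hw (K := K) hK
  refine ⟨_, hmem, hsub fun n hn => ?_⟩
  rw [← hw.maxPlusComb_const (c n)]
  exact hw.abs_maxPlusComb_sub_lt fun i hi => hx i hi n hn

/-- The Vietoris topology on `MPCC`. -/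
@[reducible]
def MPCC.topology : TopologicalSpace MPCC := vietoris _

attribute [local instance] MPCC.topology

theorem MPCC.tendsto_nhds_iff {Z : Type*} {l : Filter Z} {f : Z → MPCC} {C : MPCC} :
    Tendsto f l (𝓝 C) ↔ ∀ U, IsOpen U →
      (C.1 ⊆ U → ∀ᶠ z in l, (f z).1 ⊆ U) ∧
      ((C.1 ∩ U).Nonempty → ∀ᶠ z in l, ((f z).1 ∩ U).Nonempty) := by
  refine TopologicalSpace.tendsto_nhds_generateFrom_iff.trans ?_
  constructor
  · exact fun h U hU => ⟨h _ ⟨U, hU, Or.inl rfl⟩, h _ ⟨U, hU, Or.inr rfl⟩⟩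
  · rintro h _ ⟨U, hU, rfl | rfl⟩ hC
    · exact (h U hU).1 hC
    · exact (h U hU).2 hC

theorem MPCC.continuous_comb {Z ι : Type*} [TopologicalSpace Z] {W : Z → ι → ℝ}
    (hW : ∀ z, IsMaxWeight (W z)) (hcont : ∀ i, Continuous fun z => W z i)
    (hfin : ∀ z₀, ∃ s : Finset ι, ∀ᶠ z in 𝓝 z₀, Function.support (W z) ⊆ s) (K : ι → MPCC) :
    Continuous fun z => MPCC.comb (W z) (hW z) K := by
  have hΦ := continuous_maxPlusComb_pi (κ := ℕ) hW hcont hfin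
  refine continuous_iff_continuousAt.2 fun z₀ => MPCC.tendsto_nhds_iff.2 fun U hU => ⟨?_, ?_⟩
  · intro h
    obtain ⟨u, v, hu, -, hzu, hKv, huv⟩ := generalized_tube_lemma (isCompact_singleton (x := z₀))
      (isCompact_univ_pi fun i => (K i).2.2.1) (hU.preimage hΦ) (by
        rintro ⟨z, x⟩ ⟨rfl, hx⟩
        exact h ⟨x, hx, rfl⟩)
    filter_upwards [hu.mem_nhds (hzu rfl)] with z hz
    rintro _ ⟨x, hx, rfl⟩
    exact huv (show (z, x) ∈ _ from ⟨hz, hKv hx⟩)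
  · rintro ⟨_, ⟨x, hx, rfl⟩, hxU⟩
    have hx' : Continuous fun z : Z => (z, x) := by fun_prop
    filter_upwards [(hU.preimage (hΦ.comp hx')).mem_nhds hxU] with z hz
    exact ⟨_, ⟨x, hx, rfl⟩, hz⟩

/-- A partition of unity on the complement of a closed set `A`, with base points in `A`, which
refines as it approaches `A`. -/
theorem exists_partitionOfUnity_compl {Y : Type*} [MetricSpace Y] {A : Set Y} (hA : IsClosed A)
    (hne : A.Nonempty) :
    ∃ (ρ : PartitionOfUnity (Aᶜ : Set Y) (Aᶜ : Set Y) univ) (g : (Aᶜ : Set Y) → A),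
      ∀ i y, ρ i y ≠ 0 → ∀ a ∈ A, dist (g i : Y) a ≤ 4 * dist (y : Y) a := by
  have hpos : ∀ y : (Aᶜ : Set Y), 0 < Metric.infDist (y : Y) A := fun y =>
    (hA.notMem_iff_infDist_pos hne).1 y.2
  obtain ⟨ρ, hρ⟩ := PartitionOfUnity.exists_isSubordinate (isClosed_univ (X := (Aᶜ : Set Y)))
    (fun i : (Aᶜ : Set Y) => Metric.ball i (Metric.infDist (i : Y) A / 4))
    (fun _ => Metric.isOpen_ball)
    fun y _ => mem_iUnion.2 ⟨y, Metric.mem_ball_self (by linarith [hpos y])⟩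
  have hg : ∀ i : (Aᶜ : Set Y), ∃ a : A, dist (i : Y) a < 2 * Metric.infDist (i : Y) A := by
    intro i
    obtain ⟨a, ha, h⟩ := (Metric.infDist_lt_iff (r := 2 * Metric.infDist (i : Y) A) hne).1
      (by linarith [hpos i])
    exact ⟨⟨a, ha⟩, h⟩
  choose g hg using hg
  refine ⟨ρ, g, fun i y hy a ha => ?_⟩
  have h₁ : dist (y : Y) i < Metric.infDist (i : Y) A / 4 := hρ i (subset_tsupport _ hy)
  have h₂ : Metric.infDist (i : Y) A ≤ Metric.infDist (y : Y) A + dist (i : Y) y :=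
    Metric.infDist_le_infDist_add_dist
  have h₃ := Metric.infDist_le_dist_of_mem (x := (y : Y)) ha
  have h₄ := dist_triangle4 (g i : Y) i y a
  rw [dist_comm (i : Y) y] at h₂ h₄
  rw [dist_comm (g i : Y) i] at h₄
  linarith [hg i]

/-- Dugundji-type extension theorem for maps into `MPCC`. -/
theorem MPCC.exists_continuous_extension {Y : Type*} [MetricSpace Y] {A : Set Y}
    (hA : IsClosed A) (hne : A.Nonempty) (f : A → MPCC) (hf : Continuous f) :
    ∃ r : Y → MPCC, Continuous r ∧ ∀ a : A, r a = f a := by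
  classical
  obtain ⟨ρ, g, hg⟩ := exists_partitionOfUnity_compl hA hne
  have hW : ∀ y, IsMaxWeight fun i => ρ i y := fun y =>
    ⟨fun i => ρ.nonneg i y, ρ.locallyFinite.point_finite y, by
      obtain ⟨i, hi⟩ := ρ.exists_pos (mem_univ y)
      exact ⟨i, hi.ne'⟩⟩
  let r : Y → MPCC := fun y => if h : y ∈ A then f ⟨y, h⟩
    else MPCC.comb (fun i => ρ i ⟨y, h⟩) (hW ⟨y, h⟩) fun i => f (g i)
  have hrA : ∀ a : A, r a = f a := fun a => dif_pos a.2
  have hrAc : ∀ y : (Aᶜ : Set Y), r y = MPCC.comb (fun i => ρ i y) (hW y) fun i => f (g i) :=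
    fun y => dif_neg y.2
  refine ⟨r, continuous_iff_continuousAt.2 fun y => ?_, hrA⟩
  by_cases hy : y ∈ A
  · have hnear : ∀ P : Set (ℕ → ℝ) → Prop, (∀ᶠ a in 𝓝 (⟨y, hy⟩ : A), P (f a).1) →
        ∀ᶠ z in 𝓝 y, (∀ h : z ∈ A, P (f ⟨z, h⟩).1) ∧
          ∀ h : z ∈ Aᶜ, ∀ i, ρ i ⟨z, h⟩ ≠ 0 → P (f (g i)).1 := by
      intro P hP
      obtain ⟨δ, hδ, h⟩ := Metric.eventually_nhds_iff.1 hP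
      filter_upwards [Metric.ball_mem_nhds y (by linarith : 0 < δ / 4)] with z hz
      rw [Metric.mem_ball] at hz
      refine ⟨fun hzA => h ?_, fun hzA i hi => h ?_⟩
      · rw [Subtype.dist_eq]
        simp only
        linarith
      · have := hg i ⟨z, hzA⟩ hi y hy
        rw [Subtype.dist_eq]
        simp only at *
        linarith
    have hfy : Tendsto f (𝓝 ⟨y, hy⟩) (𝓝 (f ⟨y, hy⟩)) := hf.continuousAt
    rw [MPCC.tendsto_nhds_iff] at hfy
    rw [ContinuousAt, hrA ⟨y, hy⟩]
    refine MPCC.tendsto_nhds_iff.2 fun U hU => ⟨fun h => ?_, ?_⟩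
    · obtain ⟨V, hVU, hV, hfV, hcomb⟩ := MPCC.exists_isOpen_comb_subset _ hU h
      filter_upwards [hnear (· ⊆ V) ((hfy V hV).1 hfV)] with z hz
      by_cases hzA : z ∈ A
      · rw [hrA ⟨z, hzA⟩]
        exact (hz.1 hzA).trans hVU
      · rw [hrAc ⟨z, hzA⟩]
        exact hcomb _ _ _ (hz.2 hzA)
    · rintro ⟨c, hc, hcU⟩
      obtain ⟨V, hVU, hV, hcV, hcomb⟩ := MPCC.exists_isOpen_comb_inter_nonempty hU hcU
      filter_upwards [hnear (fun S => (S ∩ V).Nonempty) ((hfy V hV).2 ⟨c, hc, hcV⟩)] with z hz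
      by_cases hzA : z ∈ A
      · rw [hrA ⟨z, hzA⟩]
        exact (hz.1 hzA).mono (inter_subset_inter_right _ hVU)
      · rw [hrAc ⟨z, hzA⟩]
        exact hcomb _ _ _ (hz.2 hzA)
  · have hcont : Continuous fun y : (Aᶜ : Set Y) => r y := by
      simp_rw [hrAc]
      refine MPCC.continuous_comb hW (fun i => (ρ i).continuous) (fun y₀ => ?_) _
      obtain ⟨s, hs⟩ := ρ.exists_finset_nhds y₀
      exact ⟨s, hs.mono fun _ h => h.2⟩
    exact (hA.isOpen_compl.isOpenEmbedding_subtypeVal.continuousAt_iff (x := ⟨y, hy⟩)).1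
      hcont.continuousAt

theorem MPCC.metrizableSpace : TopologicalSpace.MetrizableSpace MPCC := by
  let F : MPCC → TopologicalSpace.NonemptyCompacts (ℕ → ℝ) := fun K => ⟨⟨K.1, K.2.2.1⟩, K.2.1⟩
  have hF : Function.Injective F := fun K L h => Subtype.ext (congrArg SetLike.coe h)
  have hemb : IsEmbedding F := by
    refine ⟨⟨?_⟩, hF⟩
    rw [TopologicalSpace.NonemptyCompacts.topology, induced_compose, TopologicalSpace.vietoris,
      induced_generateFrom_eq]
    refine congrArg TopologicalSpace.generateFrom (Set.ext fun S => ⟨?_, ?_⟩)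
    · rintro ⟨U, hU, rfl | rfl⟩
      · exact ⟨_, Or.inl ⟨U, hU, rfl⟩, rfl⟩
      · exact ⟨_, Or.inr ⟨U, hU, rfl⟩, rfl⟩
    · rintro ⟨_, ⟨U, hU, rfl⟩ | ⟨U, hU, rfl⟩, rfl⟩
      · exact ⟨U, hU, Or.inl rfl⟩
      · exact ⟨U, hU, Or.inr rfl⟩
  have := TopologicalSpace.metrizableSpace_of_t3_secondCountable
    (TopologicalSpace.NonemptyCompacts (ℕ → ℝ))
  exact hemb.metrizableSpace

/-- The hyperspace `mpcc(ℝ^ω)` of all nonempty compact max-plus convex subsets of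
`ℕ → ℝ`, with the Vietoris (equivalently, Hausdorff metric) topology, is an
absolute retract for metrizable spaces. -/
theorem mpcc_isAbsoluteRetract :
    letI : TopologicalSpace MPCC := vietoris _
    IsAbsoluteRetract MPCC := by
  refine ⟨MPCC.metrizableSpace, fun Y _ _ e he => ?_⟩
  let _ : MetricSpace Y := TopologicalSpace.metrizableSpaceMetric Y
  have hne : (range e).Nonempty := by
    refine ⟨e ⟨{0}, singleton_nonempty _, isCompact_singleton, ?_⟩, mem_range_self _⟩
    rintro a rfl b rfl t ht
    funext n
    simpa using ht
  obtain ⟨r, hr, hre⟩ := MPCC.exists_continuous_extension he.isClosed_range hne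
    he.isEmbedding.toHomeomorph.symm he.isEmbedding.toHomeomorph.symm.continuous
  refine ⟨r, hr, fun x => ?_⟩
  exact (hre (he.isEmbedding.toHomeomorph x)).trans
    (he.isEmbedding.toHomeomorph.symm_apply_apply x)
end

section
/- Let d be the metric on ℕ → ℝ given by d(x, y) = sup_n min(|x n − y n|, 1) / 2^(n+1) and let d_H be the induced Hausdorff metric on nonempty compact subsets. Let A, B, B' be nonempty compact max-plus convex subsets of ℕ → ℝ and r > 0 with d_H(A, B) < r and d_H(A, B') < r. Then for every real t ≤ 0, d_H(A, B ⊕ t ⊙ B') < r, where B ⊕ t ⊙ B' = { fun n => max (b n) (t + b' n) | b ∈ B, b' ∈ B' }. -/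
/-- The metric `d(x, y) = sup_n min (|x n - y n|) 1 / 2 ^ (n + 1)` on `ℕ → ℝ`. -/
noncomputable def dd (x y : ℕ → ℝ) : ℝ :=
  ⨆ n : ℕ, (min |x n - y n| 1) / 2 ^ (n + 1)

/-- The Hausdorff distance induced by `dd` on (nonempty compact) subsets of `ℕ → ℝ`. -/
noncomputable def ddH (A B : Set (ℕ → ℝ)) : ℝ :=
  max (⨆ a : A, ⨅ b : B, dd a b) (⨆ b : B, ⨅ a : A, dd a b)

lemma dd_term_le_one (x y : ℕ → ℝ) (n : ℕ) : min |x n - y n| 1 / 2 ^ (n + 1) ≤ 1 :=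
  div_le_one_of_le₀ ((min_le_right _ _).trans (one_le_pow₀ one_le_two)) (by positivity)

lemma dd_term_le_dd (x y : ℕ → ℝ) (n : ℕ) : min |x n - y n| 1 / 2 ^ (n + 1) ≤ dd x y :=
  le_ciSup (f := fun n : ℕ => min |x n - y n| 1 / 2 ^ (n + 1))
    ⟨1, Set.forall_mem_range.2 (dd_term_le_one x y)⟩ n

lemma dd_nonneg (x y : ℕ → ℝ) : 0 ≤ dd x y :=
  Real.iSup_nonneg fun _ => by positivity

lemma dd_le_one (x y : ℕ → ℝ) : dd x y ≤ 1 :=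
  ciSup_le (dd_term_le_one x y)

/-- Max-plus combinations are nonexpansive for `dd`. -/
lemma dd_maxPlusComb_le (a a' b b' : ℕ → ℝ) (t : ℝ) :
    dd (fun n => max (a n) (t + a' n)) (fun n => max (b n) (t + b' n)) ≤
      max (dd a b) (dd a' b') := by
  refine ciSup_le fun n => ?_
  have h := abs_max_sub_max_le_max (a n) (t + a' n) (b n) (t + b' n)
  rw [add_sub_add_left_eq_sub] at h
  rcases le_max_iff.1 h with h | h
  · refine le_max_of_le_left (le_trans ?_ (dd_term_le_dd a b n))
    gcongr
  · refine le_max_of_le_right (le_trans ?_ (dd_term_le_dd a' b' n))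
    gcongr

lemma bddBelow_range_of_dd {α : Type*} (f g : α → ℕ → ℝ) :
    BddBelow (Set.range fun i => dd (f i) (g i)) :=
  ⟨0, Set.forall_mem_range.2 fun _ => dd_nonneg _ _⟩

lemma bddAbove_range_iInf_dd {α β : Type*} [Nonempty β] (f g : α → β → ℕ → ℝ) :
    BddAbove (Set.range fun i => ⨅ j, dd (f i j) (g i j)) :=
  ⟨1, Set.forall_mem_range.2 fun i =>
    (ciInf_le (bddBelow_range_of_dd (f i) (g i)) (Classical.arbitrary β)).trans (dd_le_one _ _)⟩

lemma exists_dd_lt_of_ddH_lt_left {A B : Set (ℕ → ℝ)} (hB : B.Nonempty) {s : ℝ}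
    (h : ddH A B < s) {a : ℕ → ℝ} (ha : a ∈ A) : ∃ b ∈ B, dd a b < s := by
  have := hB.to_subtype
  have hlt : ⨅ b : B, dd a b < s :=
    (le_ciSup (bddAbove_range_iInf_dd (fun (a : A) (_ : B) => (a : ℕ → ℝ)) fun _ b => b)
      ⟨a, ha⟩).trans_lt ((le_max_left _ _).trans_lt h)
  obtain ⟨b, hb⟩ := exists_lt_of_ciInf_lt hlt
  exact ⟨b, b.2, hb⟩

lemma exists_dd_lt_of_ddH_lt_right {A B : Set (ℕ → ℝ)} (hA : A.Nonempty) {s : ℝ}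
    (h : ddH A B < s) {b : ℕ → ℝ} (hb : b ∈ B) : ∃ a ∈ A, dd a b < s := by
  have := hA.to_subtype
  have hlt : ⨅ a : A, dd a b < s :=
    (le_ciSup (bddAbove_range_iInf_dd (fun (_ : B) (a : A) => (a : ℕ → ℝ)) fun b _ => b)
      ⟨b, hb⟩).trans_lt ((le_max_right _ _).trans_lt h)
  obtain ⟨a, ha⟩ := exists_lt_of_ciInf_lt hlt
  exact ⟨a, a.2, ha⟩

lemma ddH_le {A B : Set (ℕ → ℝ)} (hA : A.Nonempty) (hB : B.Nonempty) {s : ℝ}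
    (hAB : ∀ a ∈ A, ∃ b ∈ B, dd a b ≤ s) (hBA : ∀ b ∈ B, ∃ a ∈ A, dd a b ≤ s) :
    ddH A B ≤ s := by
  have := hA.to_subtype
  have := hB.to_subtype
  refine max_le (ciSup_le fun a => ?_) (ciSup_le fun b => ?_)
  · obtain ⟨b, hb, hab⟩ := hAB a a.2
    exact ciInf_le_of_le (bddBelow_range_of_dd (fun _ : B => (a : ℕ → ℝ)) fun b => b)
      ⟨b, hb⟩ hab
  · obtain ⟨a, ha, hab⟩ := hBA b b.2
    exact ciInf_le_of_le (bddBelow_range_of_dd (fun a : A => (a : ℕ → ℝ)) fun _ => b)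
      ⟨a, ha⟩ hab

/-- If `A`, `B`, `B'` are nonempty compact max-plus convex subsets of `ℕ → ℝ` with
`d_H(A, B) < r` and `d_H(A, B') < r`, then for every `t ≤ 0`,
`d_H(A, B ⊕ t ⊙ B') < r`. -/
theorem ddH_maxPlusComb_lt (A B B' : Set (ℕ → ℝ))
    (hA : A.Nonempty ∧ IsCompact A ∧ MaxPlusConvex A)
    (hB : B.Nonempty ∧ IsCompact B ∧ MaxPlusConvex B)
    (hB' : B'.Nonempty ∧ IsCompact B' ∧ MaxPlusConvex B')
    (r : ℝ) (hr : 0 < r) (hAB : ddH A B < r) (hAB' : ddH A B' < r)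
    (t : ℝ) (ht : t ≤ 0) :
    ddH A {x | ∃ b ∈ B, ∃ b' ∈ B', x = fun n => max (b n) (t + b' n)} < r := by
  obtain ⟨s, hs, hsr⟩ := exists_between (max_lt hAB hAB')
  obtain ⟨hs₁, hs₂⟩ := max_lt_iff.1 hs
  obtain ⟨b₀, hb₀⟩ := hB.1
  obtain ⟨c₀, hc₀⟩ := hB'.1
  refine lt_of_le_of_lt (ddH_le hA.1 ?_ ?_ ?_) hsr
  · exact ⟨_, b₀, hb₀, c₀, hc₀, rfl⟩
  · intro a ha
    obtain ⟨b, hb, hab⟩ := exists_dd_lt_of_ddH_lt_left hB.1 hs₁ ha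
    obtain ⟨c, hc, hac⟩ := exists_dd_lt_of_ddH_lt_left hB'.1 hs₂ ha
    refine ⟨_, ⟨b, hb, c, hc, rfl⟩, ?_⟩
    have haa : (fun n => max (a n) (t + a n)) = a :=
      funext fun n => max_eq_left (by linarith)
    have h := dd_maxPlusComb_le a a b c t
    rw [haa] at h
    exact h.trans (max_le hab.le hac.le)
  · rintro _ ⟨b, hb, c, hc, rfl⟩
    obtain ⟨a, ha, hab⟩ := exists_dd_lt_of_ddH_lt_right hA.1 hs₁ hb
    obtain ⟨a', ha', hac⟩ := exists_dd_lt_of_ddH_lt_right hA.1 hs₂ hc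
    exact ⟨_, hA.2.2 a ha a' ha' t ht,
      (dd_maxPlusComb_le a a' b c t).trans (max_le hab.le hac.le)⟩
end

section
/- The hyperspace mpcc(ℝ^ω) of all nonempty compact max-plus convex subsets of ℕ → ℝ, topologized by the Hausdorff metric (equivalently, the Vietoris topology), is homeomorphic to ℕ → ℝ with the product topology. -/
open Set Filter Topology

lemma exists_upper_gauge {Z : Type*} [PseudoMetricSpace Z] {W : Set (Z × ℝ)} (hW : IsOpen W) :
    ∃ A : Z × ℝ → ℝ, ContinuousOn A W ∧ (∀ p, 0 ≤ A p) ∧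
      (∀ z y y', y ≤ y' → (z, y') ∈ W → A (z, y) ≤ A (z, y')) ∧
      ∀ z y₀, (z, y₀) ∈ W → ∀ M, ∃ y, y₀ ≤ y ∧ (z, y) ∈ W ∧ M < y + A (z, y) := by
  set U : Set (Z × ℝ) := {p | ∀ t : ℝ, 0 ≤ t → (p.1, p.2 + t) ∉ W} with hU
  have hUc : IsClosed U := by
    have : U = ⋂ t : ℝ, ⋂ _ : 0 ≤ t, (fun p : Z × ℝ => (p.1, p.2 + t)) ⁻¹' Wᶜ := by
      ext p; simp [hU]
    rw [this]
    exact isClosed_iInter fun t => isClosed_iInter fun _ =>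
      hW.isClosed_compl.preimage (by fun_prop)
  have hUW : ∀ p ∈ W, p ∉ U := fun p hp hpU => hpU 0 le_rfl (by simpa using hp)
  have hpos : U.Nonempty → ∀ p ∈ W, 0 < Metric.infDist p U := fun hne p hp =>
    (hUc.notMem_iff_infDist_pos hne).1 (hUW p hp)
  refine ⟨fun p => (Metric.infDist p U)⁻¹, ?_, fun p => inv_nonneg.2 Metric.infDist_nonneg, ?_, ?_⟩
  · rcases U.eq_empty_or_nonempty with h | h
    · simp [h, continuousOn_const]
    · exact (Metric.continuous_infDist_pt U).continuousOn.inv₀ fun p hp => (hpos h p hp).ne'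
  · intro z y y' hyy hW'
    rcases U.eq_empty_or_nonempty with h | h
    · simp [h]
    · refine inv_anti₀ (hpos h _ hW') ?_
      refine (Metric.le_infDist h).2 fun q hq => ?_
      have hq' : ((q.1, q.2 + (y' - y)) : Z × ℝ) ∈ U := fun t ht => by
        have := hq (y' - y + t) (by linarith)
        simpa [add_assoc] using this
      refine (Metric.infDist_le_dist_of_mem hq').trans (le_of_eq ?_)
      simp only [Prod.dist_eq, Real.dist_eq]
      congr 2
      ring
  · intro z y₀ h₀ M
    by_cases hb : BddAbove {y | (z, y) ∈ W}
    · set S := {y | (z, y) ∈ W} with hS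
      have hSo : IsOpen S := hW.preimage (by fun_prop)
      have huS : sSup S ∉ S := by
        intro h
        obtain ⟨ε, hε, hball⟩ := Metric.isOpen_iff.1 hSo _ h
        have : sSup S + ε / 2 ∈ S := hball (by
          simp only [Metric.mem_ball, Real.dist_eq, add_sub_cancel_left]
          rw [abs_of_pos (by linarith)]; linarith)
        linarith [le_csSup hb this]
      have hu : ((z, sSup S) : Z × ℝ) ∈ U := by
        intro t ht hmem
        have h1 : sSup S + t ≤ sSup S := le_csSup hb hmem
        have h2 : t = 0 := by linarith
        subst h2
        rw [add_zero] at hmem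
        exact huS hmem
      have hlt : y₀ < sSup S := lt_of_le_of_ne (le_csSup hb h₀) fun h => huS (h ▸ h₀)
      set δ := (|M| + |y₀| + 1)⁻¹ with hδ
      have hδ0 : 0 < δ := by positivity
      obtain ⟨y, hyS, hy⟩ := exists_lt_of_lt_csSup ⟨y₀, h₀⟩
        (max_lt hlt (sub_lt_self (sSup S) hδ0))
      refine ⟨y, ((le_max_left _ _).trans_lt hy).le, hyS, ?_⟩
      have h1 : Metric.infDist (z, y) U ≤ δ := by
        refine (Metric.infDist_le_dist_of_mem hu).trans ?_
        have h3 := le_csSup hb hyS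
        have h4 := (le_max_right _ _).trans_lt hy
        simp only [Prod.dist_eq, dist_self, Real.dist_eq]
        rw [max_eq_right (abs_nonneg _), abs_sub_comm, abs_of_nonneg (by linarith)]
        linarith
      have h2 : |M| + |y₀| + 1 ≤ (Metric.infDist (z, y) U)⁻¹ := by
        rw [← inv_inv (|M| + |y₀| + 1)]
        exact inv_anti₀ (hpos ⟨_, hu⟩ _ hyS) h1
      have h3 := (le_max_left _ _).trans_lt hy
      simp only
      linarith [neg_abs_le y₀, le_abs_self M]
    · rw [not_bddAbove_iff] at hb
      obtain ⟨y, hy, hlt⟩ := hb (max y₀ M)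
      refine ⟨y, ((le_max_left _ _).trans_lt hlt).le, hy, ?_⟩
      have : 0 ≤ (Metric.infDist (z, y) U)⁻¹ := inv_nonneg.2 Metric.infDist_nonneg
      have := (le_max_right _ _).trans_lt hlt
      simp only
      linarith

lemma exists_fiberwise_homeomorph {Z : Type*} [PseudoMetricSpace Z] {W : Set (Z × ℝ)}
    (hW : IsOpen W) (hne : ∀ z, ∃ y, (z, y) ∈ W) (hc : ∀ z, OrdConnected {y | (z, y) ∈ W}) :
    ∃ φ ψ : Z × ℝ → ℝ, ContinuousOn φ W ∧ Continuous ψ ∧ (∀ p, (p.1, ψ p) ∈ W) ∧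
      (∀ p, φ (p.1, ψ p) = p.2) ∧ ∀ p ∈ W, ψ (p.1, φ p) = p.2 := by
  obtain ⟨A, hAc, hA0, hAm, hAg⟩ := exists_upper_gauge hW
  set ν : Z × ℝ → Z × ℝ := fun p => (p.1, -p.2) with hν
  have hνc : Continuous ν := by fun_prop
  obtain ⟨B, hBc, hB0, hBm, hBg⟩ := exists_upper_gauge (hW.preimage hνc)
  set φ : Z × ℝ → ℝ := fun p => p.2 + A p - B (ν p) with hφ
  have hφc : ContinuousOn φ W := by
    refine (continuous_snd.continuousOn.add hAc).sub (hBc.comp hνc.continuousOn ?_)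
    intro p hp
    simpa [hν] using hp
  have hmono : ∀ z y y', y < y' → (z, y) ∈ W → (z, y') ∈ W → φ (z, y) < φ (z, y') := by
    intro z y y' hlt h h'
    have h1 := hAm z y y' hlt.le h'
    have h2 := hBm z (-y') (-y) (by linarith) (by simpa [hν] using h)
    simp only [hφ, hν]
    linarith
  have hex : ∀ p : Z × ℝ, ∃ y, (p.1, y) ∈ W ∧ φ (p.1, y) = p.2 := by
    rintro ⟨z, t⟩
    obtain ⟨y₀, h₀⟩ := hne z
    obtain ⟨y₁, hy₁, h₁, hM₁⟩ := hAg z y₀ h₀ (t + B (ν (z, y₀)))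
    obtain ⟨y₂, hy₂, h₂, hM₂⟩ := hBg z (-y₀) (by simpa [hν] using h₀) (-t + A (z, y₀))
    have h₂' : (z, -y₂) ∈ W := h₂
    have e1 : t ≤ φ (z, y₁) := by
      have := hBm z (-y₁) (-y₀) (by linarith) (by simpa [hν] using h₀)
      simp only [hφ, hν] at hM₁ ⊢
      linarith
    have e2 : φ (z, -y₂) ≤ t := by
      have := hAm z (-y₂) y₀ (by linarith) h₀
      simp only [hφ, hν, neg_neg] at hM₂ ⊢
      linarith
    have hpc : IsPreconnected {y | (z, y) ∈ W} := (hc z).isPreconnected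
    have hcont : ContinuousOn (fun y => φ (z, y)) {y | (z, y) ∈ W} :=
      hφc.comp (by fun_prop) fun y hy => hy
    obtain ⟨y, hy, hyt⟩ := hpc.intermediate_value h₂' h₁ hcont ⟨e2, e1⟩
    exact ⟨y, hy, hyt⟩
  choose ψ hψW hψ using hex
  have hlt : ∀ p y, (p.1, y) ∈ W → (ψ p < y ↔ p.2 < φ (p.1, y)) := by
    intro p y hy
    constructor
    · intro h; rw [← hψ p]; exact hmono _ _ _ h (hψW p) hy
    · intro h
      by_contra hcon
      rcases (not_lt.1 hcon).lt_or_eq with h1 | h1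
      · have := hmono _ _ _ h1 hy (hψW p); rw [hψ] at this; linarith
      · rw [h1, hψ] at h; exact lt_irrefl _ h
  have hgt : ∀ p y, (p.1, y) ∈ W → (y < ψ p ↔ φ (p.1, y) < p.2) := by
    intro p y hy
    constructor
    · intro h; rw [← hψ p]; exact hmono _ _ _ h hy (hψW p)
    · intro h
      by_contra hcon
      rcases (not_lt.1 hcon).lt_or_eq with h1 | h1
      · have := hmono _ _ _ h1 (hψW p) hy; rw [hψ] at this; linarith
      · rw [← h1, hψ] at h; exact lt_irrefl _ h
  refine ⟨φ, ψ, hφc, ?_, hψW, hψ, ?_⟩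
  · rw [continuous_iff_continuousAt]
    intro p
    have hSo : IsOpen {y | (p.1, y) ∈ W} := hW.preimage (by fun_prop)
    have hloc : ∀ y, (p.1, y) ∈ W → ∀ᶠ q : Z × ℝ in 𝓝 p, (q.1, y) ∈ W := fun y hy =>
      (show Continuous fun q : Z × ℝ => (q.1, y) by fun_prop).continuousAt.eventually
        (hW.mem_nhds hy)
    have hφl : ∀ y, (p.1, y) ∈ W →
        Tendsto (fun q : Z × ℝ => φ (q.1, y)) (𝓝 p) (𝓝 (φ (p.1, y))) := fun y hy =>
      ContinuousAt.comp (f := fun q : Z × ℝ => (q.1, y)) (g := φ)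
        (hφc.continuousAt (hW.mem_nhds hy)) (by fun_prop)
    rw [ContinuousAt, tendsto_order]
    obtain ⟨ε, hε, hball⟩ := Metric.isOpen_iff.1 hSo _ (hψW p)
    constructor
    · intro a ha
      set y := max ((a + ψ p) / 2) (ψ p - ε / 2) with hy
      have hy1 : y < ψ p := max_lt (by linarith) (by linarith)
      have hy2 : a < y := lt_of_lt_of_le (by linarith) (le_max_left _ _)
      have hyW : (p.1, y) ∈ W := hball (by
        rw [Metric.mem_ball, Real.dist_eq, abs_sub_comm, abs_of_pos (by linarith)]
        linarith [le_max_right ((a + ψ p) / 2) (ψ p - ε / 2)])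
      filter_upwards [hloc y hyW,
        (hφl y hyW).eventually_lt continuous_snd.continuousAt ((hgt p y hyW).1 hy1)] with q h1 h2
      exact hy2.trans ((hgt q y h1).2 h2)
    · intro a ha
      set y := min ((a + ψ p) / 2) (ψ p + ε / 2) with hy
      have hy1 : ψ p < y := lt_min (by linarith) (by linarith)
      have hy2 : y < a := lt_of_le_of_lt (min_le_left _ _) (by linarith)
      have hyW : (p.1, y) ∈ W := hball (by
        rw [Metric.mem_ball, Real.dist_eq, abs_of_pos (by linarith)]
        linarith [min_le_right ((a + ψ p) / 2) (ψ p + ε / 2)])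
      filter_upwards [hloc y hyW,
        continuous_snd.continuousAt.eventually_lt (hφl y hyW) ((hlt p y hyW).1 hy1)] with q h1 h2
      exact ((hlt q y h1).2 h2).trans hy2
  · rintro ⟨z, y⟩ hp
    rcases lt_trichotomy (ψ (z, φ (z, y))) y with h | h | h
    · exact absurd ((hlt _ y hp).1 h) (lt_irrefl _)
    · exact h
    · exact absurd ((hgt _ y hp).1 h) (lt_irrefl _)

lemma nonempty_homeomorph_of_tower {B : Type*} [TopologicalSpace B]
    [TopologicalSpace.MetrizableSpace B]
    (W : ℕ → Set (B × (ℕ → ℝ))) (hopen : ∀ n, IsOpen (W n)) (h0 : W 0 = univ)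
    (hdep : ∀ n b r r', (∀ k < n, r k = r' k) → (b, r) ∈ W n → (b, r') ∈ W n)
    (hne : ∀ n b r, (b, r) ∈ W n → ∃ y, (b, Function.update r n y) ∈ W (n + 1))
    (hc : ∀ n b r, (b, r) ∈ W n → OrdConnected {y | (b, Function.update r n y) ∈ W (n + 1)}) :
    Nonempty ({p : B × (ℕ → ℝ) // ∀ n, p ∈ W n} ≃ₜ B × (ℕ → ℝ)) := by
  let _ : MetricSpace B := TopologicalSpace.metrizableSpaceMetric B
  let _ : MetricSpace (ℕ → ℝ) := TopologicalSpace.metrizableSpaceMetric (ℕ → ℝ)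
  have hfib := fun n => exists_fiberwise_homeomorph (Z := W n)
    (W := {q | (q.1.1.1, Function.update q.1.1.2 n q.2) ∈ W (n + 1)})
    ((hopen (n + 1)).preimage (by fun_prop)) (fun z => hne n _ _ z.2) (fun z => hc n _ _ z.2)
  choose φ ψ hφ hψ hψW hφψ hψφ using hfib
  let tr : ℕ → (ℕ → ℝ) → ℕ → ℝ := fun n r k => if k < n then r k else 0
  have htr : ∀ n r, ∀ k < n, r k = tr n r k := fun n r k hk => by simp [tr, hk]
  have htrc : ∀ n, Continuous (tr n) := fun n => by
    refine continuous_pi fun k => ?_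
    by_cases hk : k < n
    · simpa [tr, hk] using continuous_apply k
    · simpa [tr, hk] using continuous_const
  have htr_update : ∀ n r, Function.update (tr n r) n (r n) = tr (n + 1) r := by
    intro n r
    ext k
    rcases lt_trichotomy k n with h | h | h
    · simp [tr, Function.update_of_ne h.ne, h, h.trans (Nat.lt_succ_self n)]
    · subst h; simp [tr]
    · simp [tr, Function.update_of_ne h.ne', not_lt.2 h.le, Nat.not_lt.2 (Nat.succ_le_of_lt h)]
  -- truncations of the inverse
  let G : ∀ n, {g : C(B × (ℕ → ℝ), ℕ → ℝ) // ∀ p, (p.1, g p) ∈ W n} := fun n =>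
    Nat.rec ⟨ContinuousMap.const _ 0, fun p => by simp [h0]⟩ (fun n g =>
      ⟨⟨fun p => Function.update (g.1 p) n (ψ n (⟨(p.1, g.1 p), g.2 p⟩, p.2 n)), by
        have := hψ n
        fun_prop⟩, fun p => hψW n (⟨(p.1, g.1 p), g.2 p⟩, p.2 n)⟩) n
  have hG0 : ∀ p, (G 0).1 p = 0 := fun p => rfl
  have hGs : ∀ n p, (G (n + 1)).1 p =
      Function.update ((G n).1 p) n (ψ n (⟨(p.1, (G n).1 p), (G n).2 p⟩, p.2 n)) :=
    fun n p => rfl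
  let inv : B × (ℕ → ℝ) → ℕ → ℝ := fun p n => (G (n + 1)).1 p n
  have hinv : ∀ n p, (G n).1 p = tr n (inv p) := by
    intro n p
    induction n with
    | zero => ext k; simp [hG0, tr]
    | succ n ih =>
      rw [← htr_update, ← ih]
      simp only [inv, hGs, Function.update_self]
  have hinvW : ∀ p n, (p.1, inv p) ∈ W n := fun p n =>
    hdep n _ _ _ (fun k hk => (htr n _ k hk).symm) (hinv n p ▸ (G n).2 p)
  have hinv_apply : ∀ p n, inv p n = ψ n (⟨(p.1, (G n).1 p), (G n).2 p⟩, p.2 n) := by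
    intro p n
    simp only [inv, hGs, Function.update_self]
  have htrW : ∀ (p : {p : B × (ℕ → ℝ) // ∀ n, p ∈ W n}) n, (p.1.1, tr n p.1.2) ∈ W n :=
    fun p n => hdep n _ _ _ (htr n _) (p.2 n)
  let fwd : {p : B × (ℕ → ℝ) // ∀ n, p ∈ W n} → ℕ → ℝ := fun p n =>
    φ n (⟨(p.1.1, tr n p.1.2), htrW p n⟩, p.1.2 n)
  refine ⟨⟨⟨fun p => (p.1.1, fwd p), fun q => ⟨(q.1, inv q), hinvW q⟩, ?_, ?_⟩, ?_, ?_⟩⟩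
  · rintro ⟨⟨b, r⟩, hp⟩
    have key : ∀ n, (G n).1 (b, fwd ⟨(b, r), hp⟩) = tr n r := by
      intro n
      induction n with
      | zero => ext k; simp [hG0, tr]
      | succ n ih =>
        rw [hGs, ← htr_update]
        simp only [ih, fwd]
        congr 1
        refine hψφ n (⟨(b, tr n r), htrW ⟨(b, r), hp⟩ n⟩, r n) ?_
        simp only [mem_ofPred_eq, htr_update]
        exact htrW ⟨(b, r), hp⟩ (n + 1)
    refine Subtype.ext (Prod.ext rfl ?_)
    ext n
    simp [inv, key, tr]
  · rintro ⟨b, s⟩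
    refine Prod.ext rfl ?_
    ext n
    simp only [fwd, ← hinv, hinv_apply]
    exact hφψ n (⟨(b, (G n).1 (b, s)), (G n).2 (b, s)⟩, s n)
  · refine (continuous_fst.comp continuous_subtype_val).prodMk (continuous_pi fun n => ?_)
    refine (hφ n).comp_continuous (f := fun p : {p : B × (ℕ → ℝ) // ∀ n, p ∈ W n} =>
      ((⟨(p.1.1, tr n p.1.2), htrW p n⟩ : W n), p.1.2 n)) ?_ ?_
    · have := htrc n
      fun_prop
    · intro p
      simp only [mem_ofPred_eq, htr_update]
      exact htrW p (n + 1)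
  · refine Continuous.subtype_mk (continuous_fst.prodMk (continuous_pi fun n => ?_)) _
    exact (continuous_apply n).comp (G (n + 1)).1.continuous

/-- The coordinate estimated at step `n`; every coordinate is estimated infinitely often. -/
def hintCoord (n : ℕ) : ℕ := (Nat.unpair n).1

/-- The precision of the estimate made at step `n`. -/
noncomputable def hintRadius (n : ℕ) : ℝ := 1 / (n + 1 : ℝ)

/-- The first `n` estimates `r k ± hintRadius k` of the same coordinate are strictly nested. -/
def NestedHints (n : ℕ) (r : ℕ → ℝ) : Prop :=
  ∀ k < n, ∀ m < k, hintCoord m = hintCoord k → |r k - r m| < hintRadius m - hintRadius k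

/-- The first `n` estimates `r k ± hintRadius k` are correct for the point `p`. -/
def CorrectHints (n : ℕ) (p r : ℕ → ℝ) : Prop :=
  ∀ k < n, |p (hintCoord k) - r k| < hintRadius k

lemma hintRadius_pos (n : ℕ) : 0 < hintRadius n := by unfold hintRadius; positivity

lemma hintRadius_lt {m n : ℕ} (h : m < n) : hintRadius n < hintRadius m := by
  unfold hintRadius
  have : (m : ℝ) < n := by exact_mod_cast h
  exact one_div_lt_one_div_of_lt (by positivity) (by linarith)

lemma exists_hintCoord_eq (i N : ℕ) : ∃ n ≥ N, hintCoord n = i :=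
  ⟨Nat.pair i N, Nat.right_le_pair i N, by simp [hintCoord]⟩

lemma exists_hintRadius_lt (i N : ℕ) {ε : ℝ} (hε : 0 < ε) :
    ∃ n ≥ N, hintCoord n = i ∧ hintRadius n < ε := by
  obtain ⟨M, hM⟩ := exists_nat_one_div_lt hε
  obtain ⟨n, hn, hni⟩ := exists_hintCoord_eq i (max N (M + 1))
  exact ⟨n, (le_max_left _ _).trans hn, hni,
    (hintRadius_lt (lt_of_lt_of_le (Nat.lt_succ_self M) ((le_max_right _ _).trans hn))).trans hM⟩

lemma NestedHints.congr {n : ℕ} {r r' : ℕ → ℝ} (h : NestedHints n r) (hr : ∀ k < n, r k = r' k) :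
    NestedHints n r' := fun k hk m hm hc => by
  rw [← hr k hk, ← hr m (hm.trans hk)]; exact h k hk m hm hc

lemma CorrectHints.congr {n : ℕ} {p r r' : ℕ → ℝ} (h : CorrectHints n p r)
    (hr : ∀ k < n, r k = r' k) : CorrectHints n p r' := fun k hk => by
  rw [← hr k hk]; exact h k hk

lemma update_eq_of_lt {n k : ℕ} (hk : k < n) (r : ℕ → ℝ) (y : ℝ) :
    Function.update r n y k = r k := Function.update_of_ne hk.ne _ _

lemma nestedHints_update_iff {n : ℕ} {r : ℕ → ℝ} {y : ℝ} :
    NestedHints (n + 1) (Function.update r n y) ↔ NestedHints n r ∧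
      ∀ m < n, hintCoord m = hintCoord n → |y - r m| < hintRadius m - hintRadius n := by
  constructor
  · refine fun h => ⟨fun k hk m hm hc => ?_, fun m hm hc => ?_⟩
    · simpa [update_eq_of_lt hk, update_eq_of_lt (hm.trans hk)] using
        h k (hk.trans n.lt_succ_self) m hm hc
    · simpa [update_eq_of_lt hm] using h n n.lt_succ_self m hm hc
  · rintro ⟨h, h'⟩ k hk m hm hc
    rcases Nat.lt_succ_iff_lt_or_eq.1 hk with hk | rfl
    · simpa [update_eq_of_lt hk, update_eq_of_lt (hm.trans hk)] using h k hk m hm hc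
    · simpa [update_eq_of_lt hm] using h' m hm hc

lemma correctHints_update_iff {n : ℕ} {p r : ℕ → ℝ} {y : ℝ} :
    CorrectHints (n + 1) p (Function.update r n y) ↔ CorrectHints n p r ∧
      |p (hintCoord n) - y| < hintRadius n := by
  constructor
  · refine fun h => ⟨fun k hk => ?_, ?_⟩
    · simpa [update_eq_of_lt hk] using h k (hk.trans n.lt_succ_self)
    · simpa using h n n.lt_succ_self
  · rintro ⟨h, h'⟩ k hk
    rcases Nat.lt_succ_iff_lt_or_eq.1 hk with hk | rfl
    · simpa [update_eq_of_lt hk] using h k hk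
    · simpa using h'

/-- Correct nested estimates can be continued. -/
lemma exists_update_hints {n : ℕ} {p r : ℕ → ℝ} (hn : NestedHints n r) (hp : CorrectHints n p r) :
    ∃ y, NestedHints (n + 1) (Function.update r n y) ∧
      CorrectHints (n + 1) p (Function.update r n y) := by
  simp only [nestedHints_update_iff, correctHints_update_iff]
  set x := p (hintCoord n)
  rcases Finset.eq_empty_or_nonempty {m ∈ Finset.range n | hintCoord m = hintCoord n} with hF | hF
  · refine ⟨x, ⟨hn, fun m hm hc => ?_⟩, hp, by simpa using hintRadius_pos n⟩
    have : m ∈ ({m ∈ Finset.range n | hintCoord m = hintCoord n} : Finset ℕ) := by simp [hm, hc]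
    simp [hF] at this
  · obtain ⟨j, hj, hmax⟩ := Finset.exists_max_image _ id hF
    simp only [Finset.mem_filter, Finset.mem_range] at hj hmax
    have hjn := hintRadius_lt hj.1
    have hx : |x - r j| < hintRadius j := by
      have := hp j hj.1
      rwa [hj.2] at this
    have h0 := hintRadius_pos n
    have hj0 := hintRadius_pos j
    -- the point at parameter `1 - hintRadius n / hintRadius j` on the way from `r j` to `x`
    obtain ⟨y, hy1, hy2⟩ : ∃ y, |y - r j| < hintRadius j - hintRadius n ∧
        |x - y| < hintRadius n := by
      rw [abs_lt] at hx
      obtain ⟨y, h1, h2⟩ := exists_between (a₁ := max (r j - (hintRadius j - hintRadius n))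
        (x - hintRadius n)) (a₂ := min (r j + (hintRadius j - hintRadius n)) (x + hintRadius n))
        (by rw [max_lt_iff, lt_min_iff, lt_min_iff]; constructor <;> constructor <;> linarith)
      rw [max_lt_iff] at h1
      rw [lt_min_iff] at h2
      exact ⟨y, abs_lt.2 ⟨by linarith, by linarith⟩, abs_lt.2 ⟨by linarith, by linarith⟩⟩
    refine ⟨y, ⟨hn, fun m hm hc => ?_⟩, hp, hy2⟩
    rcases (hmax m ⟨hm, hc⟩).lt_or_eq with h | h
    · have h1 := hn j hj.1 m h (hc.trans hj.2.symm)
      have h2 := abs_sub_le y (r j) (r m)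
      linarith
    · have : m = j := h
      rw [this]; exact hy1

lemma isOpen_nestedHints (n : ℕ) : IsOpen {r | NestedHints n r} := by
  have : {r | NestedHints n r} = ⋂ k ∈ Iio n, ⋂ m ∈ Iio k, {r | hintCoord m = hintCoord k →
      |r k - r m| < hintRadius m - hintRadius k} := by
    ext; simp [NestedHints]
  rw [this]
  refine (finite_Iio n).isOpen_biInter fun k _ => (finite_Iio k).isOpen_biInter fun m _ => ?_
  by_cases h : hintCoord m = hintCoord k
  · simp only [h, true_imp_iff]
    exact isOpen_lt (by fun_prop) continuous_const
  · simp [h]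

lemma isOpen_correctHints (n : ℕ) :
    IsOpen {q : (ℕ → ℝ) × (ℕ → ℝ) | CorrectHints n q.1 q.2} := by
  have : {q : (ℕ → ℝ) × (ℕ → ℝ) | CorrectHints n q.1 q.2} = ⋂ k ∈ Iio n,
      {q | |q.1 (hintCoord k) - q.2 k| < hintRadius k} := by
    ext; simp [CorrectHints]
  rw [this]
  exact (finite_Iio n).isOpen_biInter fun k _ => isOpen_lt (by fun_prop) continuous_const

lemma ordConnected_abs_sub_lt (a c : ℝ) : OrdConnected {y : ℝ | |y - a| < c} := by
  have : {y : ℝ | |y - a| < c} = Metric.ball a c := by ext; simp [Real.dist_eq]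
  rw [this, Real.ball_eq_Ioo]
  exact ordConnected_Ioo

lemma ordConnected_nested_update {n : ℕ} {r : ℕ → ℝ} (h : NestedHints n r) :
    OrdConnected {y | NestedHints (n + 1) (Function.update r n y)} := by
  have : {y | NestedHints (n + 1) (Function.update r n y)} = ⋂ m, ⋂ _ : m < n,
      ⋂ _ : hintCoord m = hintCoord n, {y | |y - r m| < hintRadius m - hintRadius n} := by
    ext; simp [nestedHints_update_iff, h]
  rw [this]
  exact ordConnected_iInter fun m => ordConnected_iInter fun _ => ordConnected_iInter fun _ =>
    ordConnected_abs_sub_lt _ _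

/-- An infinite sequence of nested estimates, each finite part of which is correct for some point
of a closed set, is correct for some point of that set. -/
lemma exists_correctHints {C : Set (ℕ → ℝ)} (hC : IsClosed C) {r : ℕ → ℝ}
    (hn : ∀ n, NestedHints n r) (h : ∀ n, ∃ p ∈ C, CorrectHints n p r) :
    ∃ p ∈ C, ∀ n, CorrectHints n p r := by
  choose p hpC hp using h
  have hnest : ∀ m k, m < k → hintCoord m = hintCoord k →
      |r k - r m| < hintRadius m - hintRadius k := fun m k => hn (k + 1) k k.lt_succ_self m
  have hcauchy : ∀ i, CauchySeq fun n => p n i := by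
    intro i
    rw [Metric.cauchySeq_iff]
    intro ε hε
    obtain ⟨k, -, hki, hkε⟩ := exists_hintRadius_lt i 0 (half_pos hε)
    refine ⟨k + 1, fun m hm n hn => ?_⟩
    have h1 := hp m k hm
    have h2 := hp n k hn
    rw [hki] at h1 h2
    rw [abs_sub_comm] at h2
    have := abs_sub_le (p m i) (r k) (p n i)
    rw [Real.dist_eq]
    linarith
  choose q hq using fun i => cauchySeq_tendsto_of_complete (hcauchy i)
  have hle : ∀ k, |q (hintCoord k) - r k| ≤ hintRadius k := by
    intro k
    refine le_of_tendsto (((hq (hintCoord k)).sub_const (r k)).abs) ?_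
    filter_upwards [eventually_gt_atTop k] with n hn using (hp n k hn).le
  refine ⟨q, hC.mem_of_tendsto (tendsto_pi_nhds.2 hq) (Eventually.of_forall hpC), fun _ k _ => ?_⟩
  obtain ⟨m, hm, hmk⟩ := exists_hintCoord_eq (hintCoord k) (k + 1)
  have h1 := hnest k m hm hmk.symm
  have h2 := hle m
  rw [hmk] at h2
  have := abs_sub_le (q (hintCoord k)) (r m) (r k)
  linarith

/-- A closed subspace `X` of `ℝ^ω` any two points of which lie in a connected subset of the box
they span satisfies `X × ℝ^ω ≅ ℝ^ω`. -/
theorem nonempty_prod_homeomorph_pi {X : Type*} [TopologicalSpace X] [Nonempty X]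
    {f : X → ℕ → ℝ} (hf : IsClosedEmbedding f)
    (hconn : ∀ x y, ∃ S : Set X, IsPreconnected S ∧ x ∈ S ∧ y ∈ S ∧
      ∀ z ∈ S, ∀ i, f z i ∈ uIcc (f x i) (f y i)) :
    Nonempty (X × (ℕ → ℝ) ≃ₜ (ℕ → ℝ)) := by
  have : TopologicalSpace.MetrizableSpace X := hf.isEmbedding.metrizableSpace
  have hfc := hf.continuous
  -- pairs of a point of `X` and a sequence of estimates correct for it
  let V : ℕ → Set (X × (ℕ → ℝ)) := fun n => {q | NestedHints n q.2 ∧ CorrectHints n (f q.1) q.2}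
  let W : ℕ → Set (Unit × (ℕ → ℝ)) := fun n =>
    {q | NestedHints n q.2 ∧ ∃ x, CorrectHints n (f x) q.2}
  have hV : Nonempty ({q : X × (ℕ → ℝ) // ∀ n, q ∈ V n} ≃ₜ X × (ℕ → ℝ)) := by
    refine nonempty_homeomorph_of_tower V (fun n => ?_) ?_ ?_ ?_ ?_
    · exact ((isOpen_nestedHints n).preimage continuous_snd).inter
        ((isOpen_correctHints n).preimage (by fun_prop :
          Continuous fun q : X × (ℕ → ℝ) => (f q.1, q.2)))
    · ext; simp [V, NestedHints, CorrectHints]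
    · exact fun n b r r' h hr => ⟨hr.1.congr h, hr.2.congr h⟩
    · exact fun n b r hr => exists_update_hints hr.1 hr.2
    · intro n b r hr
      refine (ordConnected_nested_update hr.1).inter
        (t := {y | CorrectHints (n + 1) (f b) (Function.update r n y)}) ?_
      simp only [correctHints_update_iff, show CorrectHints n (f b) r from hr.2, true_and,
        abs_sub_comm (f b _)]
      exact ordConnected_abs_sub_lt _ _
  have hW : Nonempty ({q : Unit × (ℕ → ℝ) // ∀ n, q ∈ W n} ≃ₜ Unit × (ℕ → ℝ)) := by
    refine nonempty_homeomorph_of_tower W (fun n => ?_) ?_ ?_ ?_ ?_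
    · refine ((isOpen_nestedHints n).preimage continuous_snd).inter
        (t := {q : Unit × (ℕ → ℝ) | ∃ x, CorrectHints n (f x) q.2}) ?_
      have : {q : Unit × (ℕ → ℝ) | ∃ x, CorrectHints n (f x) q.2} = ⋃ x,
          (fun q : Unit × (ℕ → ℝ) => (f x, q.2)) ⁻¹' {q | CorrectHints n q.1 q.2} := by
        ext; simp
      rw [this]
      exact isOpen_iUnion fun x => (isOpen_correctHints n).preimage (by fun_prop)
    · ext; simp [W, NestedHints, CorrectHints]
    · exact fun n b r r' h hr => ⟨hr.1.congr h, hr.2.imp fun x hx => hx.congr h⟩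
    · rintro n b r ⟨hr, x, hx⟩
      obtain ⟨y, h1, h2⟩ := exists_update_hints hr hx
      exact ⟨y, h1, x, h2⟩
    · intro n b r hr
      refine (ordConnected_nested_update hr.1).inter
        (t := {y | ∃ x, CorrectHints (n + 1) (f x) (Function.update r n y)}) ?_
      rw [ordConnected_iff]
      rintro y₁ ⟨x₁, h₁⟩ y₂ ⟨x₂, h₂⟩ - y hy
      simp only [correctHints_update_iff] at h₁ h₂
      obtain ⟨S, hS, hx₁, hx₂, hSf⟩ := hconn x₁ x₂
      have hcor : ∀ z ∈ S, CorrectHints n (f z) r := by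
        intro z hz k hk
        exact (ordConnected_abs_sub_lt _ _).uIcc_subset (h₁.1 k hk) (h₂.1 k hk) (hSf z hz _)
      suffices ∃ z ∈ S, |f z (hintCoord n) - y| < hintRadius n by
        obtain ⟨z, hz, hzy⟩ := this
        exact ⟨z, correctHints_update_iff.2 ⟨hcor z hz, hzy⟩⟩
      have hz1 := abs_lt.1 h₁.2
      have hz2 := abs_lt.1 h₂.2
      by_cases hc1 : |f x₁ (hintCoord n) - y| < hintRadius n
      · exact ⟨x₁, hx₁, hc1⟩
      by_cases hc2 : |f x₂ (hintCoord n) - y| < hintRadius n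
      · exact ⟨x₂, hx₂, hc2⟩
      have hle1 : f x₁ (hintCoord n) ≤ y := by
        by_contra hcon
        exact hc1 (abs_lt.2 ⟨by linarith [hintRadius_pos n], by linarith [hy.1]⟩)
      have hle2 : y ≤ f x₂ (hintCoord n) := by
        by_contra hcon
        exact hc2 (abs_lt.2 ⟨by linarith [hy.2], by linarith [hintRadius_pos n]⟩)
      obtain ⟨z, hz, hzy⟩ := hS.intermediate_value hx₁ hx₂
        ((continuous_apply (hintCoord n)).comp hfc).continuousOn ⟨hle1, hle2⟩
      refine ⟨z, hz, ?_⟩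
      have : f z (hintCoord n) = y := hzy
      rw [this]
      simpa using hintRadius_pos n
  have hVW : Nonempty ({q : X × (ℕ → ℝ) // ∀ n, q ∈ V n} ≃ₜ
      {q : Unit × (ℕ → ℝ) // ∀ n, q ∈ W n}) := by
    have hex : ∀ q : {q : Unit × (ℕ → ℝ) // ∀ n, q ∈ W n}, ∃ x, ∀ n,
        CorrectHints n (f x) q.1.2 := by
      intro q
      obtain ⟨_, ⟨x, rfl⟩, hx⟩ := exists_correctHints hf.isClosed_range (fun n => (q.2 n).1)
        fun n => by
          obtain ⟨x, hx⟩ := (q.2 n).2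
          exact ⟨f x, ⟨x, rfl⟩, hx⟩
      exact ⟨x, hx⟩
    choose g hg using hex
    have huniq : ∀ (x y : X) (r : ℕ → ℝ), (∀ n, CorrectHints n (f x) r) →
        (∀ n, CorrectHints n (f y) r) → x = y := by
      intro x y r hx hy
      refine hf.injective (funext fun i => ?_)
      refine eq_of_abs_sub_le_all fun ε hε => ?_
      obtain ⟨k, -, hki, hkε⟩ := exists_hintRadius_lt i 0 (half_pos hε)
      have h1 := hx (k + 1) k k.lt_succ_self
      have h2 := hy (k + 1) k k.lt_succ_self
      rw [hki] at h1 h2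
      rw [abs_sub_comm] at h2
      have := abs_sub_le (f x i) (r k) (f y i)
      linarith
    have hgc : Continuous g := by
      rw [hf.isInducing.continuous_iff, continuous_pi_iff]
      intro i
      rw [Metric.continuous_iff']
      intro q ε hε
      obtain ⟨k, -, hki, hkε⟩ := exists_hintRadius_lt i 0 (show 0 < ε / 3 by positivity)
      have hr : Continuous fun q : {q : Unit × (ℕ → ℝ) // ∀ n, q ∈ W n} => q.1.2 k := by fun_prop
      filter_upwards [Metric.continuous_iff'.1 hr q (ε / 3) (by positivity)] with q' hq'
      have h1 := hg q' (k + 1) k k.lt_succ_self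
      have h2 := hg q (k + 1) k k.lt_succ_self
      rw [hki] at h1 h2
      rw [abs_sub_comm] at h2
      rw [Real.dist_eq] at hq' ⊢
      have e1 := abs_sub_le (f (g q') i) (q'.1.2 k) (f (g q) i)
      have e2 := abs_sub_le (q'.1.2 k) (q.1.2 k) (f (g q) i)
      simp only [Function.comp_apply]
      linarith
    refine ⟨⟨⟨fun q => ⟨((), q.1.2), fun n => ⟨(q.2 n).1, q.1.1, (q.2 n).2⟩⟩,
      fun q => ⟨(g q, q.1.2), fun n => ⟨(q.2 n).1, hg q n⟩⟩, ?_, fun q => rfl⟩, ?_, ?_⟩⟩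
    · rintro ⟨⟨x, r⟩, hq⟩
      refine Subtype.ext (Prod.ext (huniq _ _ r (hg _) fun n => (hq n).2) rfl)
    · exact Continuous.subtype_mk (by fun_prop) _
    · exact Continuous.subtype_mk (by fun_prop) _
  obtain ⟨eV⟩ := hV
  obtain ⟨eW⟩ := hW
  obtain ⟨eVW⟩ := hVW
  exact ⟨eV.symm.trans (eVW.trans (eW.trans (Homeomorph.uniqueProd _ _)))⟩

/-- The hyperspace of nonempty compact max-plus convex sets with the Vietoris topology. -/
def MPHyper : Type := MPCC

namespace MPHyper

instance : TopologicalSpace MPHyper := vietoris _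

/-- The underlying set. -/
def carrier (K : MPHyper) : Set (ℕ → ℝ) := Subtype.val K

/-- The point of the hyperspace given by a set. -/
def mk (A : Set (ℕ → ℝ)) (h₁ : A.Nonempty) (h₂ : IsCompact A) (h₃ : MaxPlusConvex A) : MPHyper :=
  ⟨A, h₁, h₂, h₃⟩

lemma nonempty (K : MPHyper) : K.carrier.Nonempty := K.property.1

lemma isCompact (K : MPHyper) : IsCompact K.carrier := K.property.2.1

lemma convex (K : MPHyper) : MaxPlusConvex K.carrier := K.property.2.2

lemma ext {K L : MPHyper} (h : K.carrier = L.carrier) : K = L := Subtype.ext h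

lemma isOpen_subset {U : Set (ℕ → ℝ)} (hU : IsOpen U) : IsOpen {K : MPHyper | K.carrier ⊆ U} :=
  TopologicalSpace.isOpen_generateFrom_of_mem ⟨U, hU, Or.inl rfl⟩

lemma isOpen_inter {U : Set (ℕ → ℝ)} (hU : IsOpen U) :
    IsOpen {K : MPHyper | (K.carrier ∩ U).Nonempty} :=
  TopologicalSpace.isOpen_generateFrom_of_mem ⟨U, hU, Or.inr rfl⟩

lemma continuous_of {T : Type*} [TopologicalSpace T] {g : T → MPHyper}
    (h₁ : ∀ U, IsOpen U → IsOpen {t | (g t).carrier ⊆ U})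
    (h₂ : ∀ U, IsOpen U → IsOpen {t | ((g t).carrier ∩ U).Nonempty}) : Continuous g := by
  refine continuous_generateFrom_iff.2 ?_
  rintro S ⟨U, hU, rfl | rfl⟩
  · exact h₁ U hU
  · exact h₂ U hU

lemma le_nhds_of {l : Filter MPHyper} {K : MPHyper}
    (h₁ : ∀ U, IsOpen U → K.carrier ⊆ U → ∀ᶠ L in l, L.carrier ⊆ U)
    (h₂ : ∀ U, IsOpen U → (K.carrier ∩ U).Nonempty → ∀ᶠ L in l, (L.carrier ∩ U).Nonempty) :
    l ≤ 𝓝 K := by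
  refine (TopologicalSpace.tendsto_nhds_generateFrom_iff (m := id) (f := l)).2 ?_
  rintro S ⟨U, hU, rfl | rfl⟩ hK
  · exact h₁ U hU hK
  · exact h₂ U hU hK

/-- The maximum of `φ` over `K`. -/
noncomputable def maxOn (φ : (ℕ → ℝ) → ℝ) (K : MPHyper) : ℝ := sSup (φ '' K.carrier)

section maxOn

variable {φ : (ℕ → ℝ) → ℝ}

lemma le_maxOn (hφ : Continuous φ) {K : MPHyper} {x : ℕ → ℝ} (hx : x ∈ K.carrier) :
    φ x ≤ maxOn φ K :=
  le_csSup (K.isCompact.image hφ).bddAbove ⟨x, hx, rfl⟩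

lemma exists_eq_maxOn (hφ : Continuous φ) (K : MPHyper) : ∃ x ∈ K.carrier, φ x = maxOn φ K :=
  (K.isCompact.image hφ).sSup_mem (K.nonempty.image φ)

lemma maxOn_le (hφ : Continuous φ) {K : MPHyper} {c : ℝ} (h : ∀ x ∈ K.carrier, φ x ≤ c) :
    maxOn φ K ≤ c := by
  obtain ⟨x, hx, hxe⟩ := exists_eq_maxOn hφ K
  exact hxe ▸ h x hx

lemma continuous_maxOn (hφ : Continuous φ) : Continuous (maxOn φ) := by
  rw [continuous_iff_continuousAt]
  intro K
  rw [ContinuousAt, tendsto_order]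
  constructor
  · intro a ha
    obtain ⟨x, hx, hxe⟩ := exists_eq_maxOn hφ K
    filter_upwards [(isOpen_inter (isOpen_lt continuous_const hφ : IsOpen {x | a < φ x})).mem_nhds
      ⟨x, hx, by simpa [hxe] using ha⟩]
    rintro L ⟨y, hy, hay⟩
    exact lt_of_lt_of_le hay (le_maxOn hφ hy)
  · intro a ha
    filter_upwards [(isOpen_subset (isOpen_lt hφ continuous_const : IsOpen {x | φ x < a})).mem_nhds
      (fun x hx => (le_maxOn hφ hx).trans_lt ha)] with L hL
    obtain ⟨x, hx, hxe⟩ := exists_eq_maxOn hφ L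
    exact hxe ▸ hL hx

end maxOn

end MPHyper

/-- Functions whose sublevel sets are max-plus convex. -/
def MaxPlusQuasiconvex (φ : (ℕ → ℝ) → ℝ) : Prop :=
  ∀ a b : ℕ → ℝ, ∀ t : ℝ, t ≤ 0 → φ (fun i => max (a i) (t + b i)) ≤ max (φ a) (φ b)

/-- The nonnegative part of the maximum of `y i - x i` over `i ∈ F`. -/
noncomputable def excess (F : Finset ℕ) (x y : ℕ → ℝ) : ℝ := F.fold max 0 fun i => y i - x i

lemma excess_le_iff {F : Finset ℕ} {x y : ℕ → ℝ} {c : ℝ} :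
    excess F x y ≤ c ↔ 0 ≤ c ∧ ∀ i ∈ F, y i - x i ≤ c := Finset.fold_max_le _

lemma excess_nonneg (F : Finset ℕ) (x y : ℕ → ℝ) : 0 ≤ excess F x y :=
  (excess_le_iff.1 le_rfl).1

lemma sub_le_excess {F : Finset ℕ} (x y : ℕ → ℝ) {i : ℕ} (hi : i ∈ F) : y i - x i ≤ excess F x y :=
  (excess_le_iff.1 le_rfl).2 i hi

lemma excess_self (F : Finset ℕ) (x : ℕ → ℝ) : excess F x x = 0 :=
  le_antisymm (excess_le_iff.2 ⟨le_rfl, by simp⟩) (excess_nonneg _ _ _)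

lemma continuous_excess (F : Finset ℕ) :
    Continuous fun q : (ℕ → ℝ) × (ℕ → ℝ) => excess F q.1 q.2 := by
  classical
  unfold excess
  induction F using Finset.induction_on with
  | empty => simpa using continuous_const
  | insert i F hi ih =>
    simp only [Finset.fold_insert hi]
    fun_prop

lemma excess_mono {F F' : Finset ℕ} (hF : F ⊆ F') {x y y' : ℕ → ℝ} (h : ∀ i, y i ≤ y' i) :
    excess F x y ≤ excess F' x y' :=
  excess_le_iff.2 ⟨excess_nonneg _ _ _, fun i hi =>
    (sub_le_sub_right (h i) _).trans (sub_le_excess x y' (hF hi))⟩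

lemma add_excess_le (F : Finset ℕ) (x y : ℕ → ℝ) {t : ℝ} (ht : t ≤ 0) :
    t + excess F x y ≤ excess F x fun i => t + y i := by
  rw [← le_sub_iff_add_le', excess_le_iff]
  refine ⟨by linarith [excess_nonneg F x fun i => t + y i], fun i hi => ?_⟩
  have := sub_le_excess x (fun i => t + y i) hi
  linarith

/-- The coordinate `j`, or the constant `0`. -/
def optCoord (j : Option ℕ) (y : ℕ → ℝ) : ℝ := j.elim 0 y

lemma continuous_optCoord (j : Option ℕ) : Continuous (optCoord j) := by
  cases j with
  | none => exact continuous_const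
  | some j => exact continuous_apply j

/-- A countable family of test functions. -/
noncomputable def testFun : (ℕ × Finset ℕ × Option ℕ) ⊕ ℕ → (ℕ → ℝ) → ℝ
  | .inl (k, F, j), y => optCoord j y - excess F (TopologicalSpace.denseSeq (ℕ → ℝ) k) y
  | .inr j, y => -y j

lemma continuous_testFun (ι) : Continuous (testFun ι) := by
  rcases ι with ⟨k, F, j⟩ | j
  · exact (continuous_optCoord j).sub
      ((continuous_excess F).comp (continuous_const.prodMk continuous_id))
  · exact (continuous_apply j).neg

lemma quasiconvex_testFun (ι) : MaxPlusQuasiconvex (testFun ι) := by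
  intro a b t ht
  rcases ι with ⟨k, F, j⟩ | j
  · set x := TopologicalSpace.denseSeq (ℕ → ℝ) k with hx
    have h1 : excess F x a ≤ excess F x fun i => max (a i) (t + b i) :=
      excess_mono subset_rfl fun i => le_max_left _ _
    have h2 : t + excess F x b ≤ excess F x fun i => max (a i) (t + b i) :=
      (add_excess_le F x b ht).trans (excess_mono subset_rfl fun i => le_max_right _ _)
    cases j with
    | none =>
      refine le_max_of_le_left ?_
      simp only [testFun, optCoord, Option.elim_none, ← hx]
      linarith
    | some j =>
      simp only [testFun, optCoord, Option.elim_some, ← hx]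
      rcases le_total (a j) (t + b j) with h | h
      · refine le_max_of_le_right ?_
        rw [max_eq_right h]; linarith
      · refine le_max_of_le_left ?_
        rw [max_eq_left h]; linarith
  · refine le_max_of_le_left ?_
    simp only [testFun]
    linarith [le_max_left (a j) (t + b j)]

namespace MPHyper

lemma sup_mem (K : MPHyper) {a b : ℕ → ℝ} (ha : a ∈ K.carrier) (hb : b ∈ K.carrier) :
    a ⊔ b ∈ K.carrier := by
  have := K.convex a ha b hb 0 le_rfl
  simpa [Pi.sup_def] using this

/-- A point is in `K` if it is dominated, at each coordinate of contact, by a multiple of a point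
of `K`. -/
lemma mem_of_forall_excess {K : MPHyper} {x : ℕ → ℝ}
    (h : ∀ j : Option ℕ, ∀ F : Finset ℕ, ∃ y ∈ K.carrier,
      excess F x y ≤ optCoord j y - optCoord j x) : x ∈ K.carrier := by
  classical
  have hlim : ∀ j : Option ℕ, ∃ y ∈ K.carrier, ∀ F : Finset ℕ,
      excess F x y ≤ optCoord j y - optCoord j x := by
    intro j
    have hcl : ∀ F : Finset ℕ, IsClosed {y | excess F x y ≤ optCoord j y - optCoord j x} :=
      fun F => isClosed_le ((continuous_excess F).comp (continuous_const.prodMk continuous_id))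
        ((continuous_optCoord j).sub continuous_const)
    obtain ⟨y, hy⟩ := IsCompact.nonempty_iInter_of_directed_nonempty_isCompact_isClosed
      (fun F : Finset ℕ => K.carrier ∩ {y | excess F x y ≤ optCoord j y - optCoord j x})
      (fun F F' => ⟨F ∪ F',
        fun y hy => ⟨hy.1, (excess_mono Finset.subset_union_left fun _ => le_rfl).trans hy.2⟩,
        fun y hy => ⟨hy.1, (excess_mono Finset.subset_union_right fun _ => le_rfl).trans hy.2⟩⟩)
      (fun F => by obtain ⟨y, hy, hF⟩ := h j F; exact ⟨y, hy, hF⟩)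
      (fun F => K.isCompact.inter_right (hcl F))
      (fun F => K.isCompact.isClosed.inter (hcl F))
    rw [mem_iInter] at hy
    exact ⟨y, (hy ∅).1, fun F => (hy F).2⟩
  obtain ⟨z, hz, hzx⟩ := hlim none
  have hzx : ∀ i, z i ≤ x i := fun i => by
    have := (excess_le_iff.1 (hzx {i})).2 i (by simp)
    simp only [optCoord, Option.elim_none] at this
    linarith
  have hw : ∀ j : ℕ, ∃ w ∈ K.carrier, w ≤ x ∧ w j = x j := by
    intro j
    obtain ⟨y, hy, hyx⟩ := hlim (some j)
    simp only [optCoord, Option.elim_some] at hyx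
    have h0 := (excess_le_iff.1 (hyx ∅)).1
    refine ⟨_, K.convex z hz y hy (x j - y j) (by linarith), fun i => max_le (hzx i) ?_, ?_⟩
    · have := (excess_le_iff.1 (hyx {i})).2 i (by simp)
      linarith
    · simp [hzx j]
  choose w hwK hwx hwj using hw
  have hsup : ∀ n, partialSups w n ∈ K.carrier := by
    intro n
    induction n with
    | zero => simpa using hwK 0
    | succ n ih => rw [partialSups_add_one]; exact K.sup_mem ih (hwK _)
  refine K.isCompact.isClosed.mem_of_tendsto (b := atTop) (tendsto_pi_nhds.2 fun i => ?_)
    (Eventually.of_forall hsup)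
  refine tendsto_const_nhds.congr' ?_
  filter_upwards [eventually_ge_atTop i] with n hn
  refine le_antisymm ?_ (partialSups_le w n x (fun k _ => hwx k) i)
  rw [← hwj i]
  exact le_partialSups_of_le w hn i

lemma exists_testFun_lt {K : MPHyper} {x : ℕ → ℝ} (hx : x ∉ K.carrier) :
    ∃ ι, ∀ y ∈ K.carrier, testFun ι y < testFun ι x := by
  have h := mt mem_of_forall_excess hx
  push Not at h
  obtain ⟨j, F, h⟩ := h
  have hc := continuous_excess F
  have hj := continuous_optCoord j
  have hev : ∀ᶠ x' in 𝓝 x, ∀ y ∈ K.carrier,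
      optCoord j y - excess F x' y < optCoord j x - excess F x' x := by
    refine K.isCompact.eventually_forall_of_forall_eventually fun y hy => ?_
    have h1 : Continuous fun q : (ℕ → ℝ) × (ℕ → ℝ) => optCoord j q.2 - excess F q.1 q.2 := by
      fun_prop
    have h2 : Continuous fun q : (ℕ → ℝ) × (ℕ → ℝ) => optCoord j x - excess F q.1 x :=
      continuous_const.sub (hc.comp (continuous_fst.prodMk continuous_const))
    refine (isOpen_lt h1 h2).mem_nhds ?_
    have := h y hy
    simp only [mem_ofPred_eq, excess_self]
    linarith
  obtain ⟨k, hk⟩ := (TopologicalSpace.denseRange_denseSeq (ℕ → ℝ)).exists_mem_open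
    isOpen_interior ⟨x, mem_interior_iff_mem_nhds.2 hev⟩
  exact ⟨.inl (k, F, j), interior_subset hk⟩

end MPHyper

namespace MPHyper

/-- Coordinates of `MPHyper` indexed by natural numbers along `e`. -/
noncomputable def coordMap (e : ℕ → (ℕ × Finset ℕ × Option ℕ) ⊕ ℕ) (K : MPHyper) (n : ℕ) : ℝ :=
  maxOn (testFun (e n)) K

variable {e : ℕ → (ℕ × Finset ℕ × Option ℕ) ⊕ ℕ}

lemma continuous_coordMap : Continuous (coordMap e) :=
  continuous_pi fun n => continuous_maxOn (continuous_testFun (e n))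

lemma injective_coordMap (he : Function.Surjective e) : Function.Injective (coordMap e) := by
  have key : ∀ K L : MPHyper, coordMap e K = coordMap e L → K.carrier ⊆ L.carrier := by
    intro K L h x hx
    by_contra hxL
    obtain ⟨ι, hι⟩ := exists_testFun_lt hxL
    obtain ⟨n, rfl⟩ := he ι
    obtain ⟨y, hy, hye⟩ := exists_eq_maxOn (continuous_testFun (e n)) L
    have h1 := le_maxOn (continuous_testFun (e n)) hx
    have h2 := hι y hy
    have h3 : maxOn (testFun (e n)) K = maxOn (testFun (e n)) L := congrFun h n
    linarith
  exact fun K L h => ext (subset_antisymm (key K L h) (key L K h.symm))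

lemma continuous_combination (t : ℝ) :
    Continuous fun q : (ℕ → ℝ) × (ℕ → ℝ) => fun i => max (q.1 i) (t + q.2 i) := by
  fun_prop

/-- An ultrafilter whose members are eventually uniformly bounded at each coordinate converges. -/
lemma exists_le_nhds_of_bounded (𝒰 : Ultrafilter MPHyper) {B : ℕ → ℝ}
    (hB : ∀ j, ∀ᶠ K in (𝒰 : Filter MPHyper), ∀ x ∈ K.carrier, x j ∈ Icc (-B j) (B j)) :
    ∃ K : MPHyper, (𝒰 : Filter MPHyper) ≤ 𝓝 K := by
  have hsel : ∀ g : MPHyper → ℕ → ℝ, (∀ᶠ K in (𝒰 : Filter MPHyper), g K ∈ K.carrier) →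
      ∃ x, Tendsto g 𝒰 (𝓝 x) ∧ ∀ j, x j ∈ Icc (-B j) (B j) := by
    intro g hg
    have : ∀ j, ∃ c ∈ Icc (-B j) (B j), Tendsto (fun K => g K j) 𝒰 (𝓝 c) := by
      intro j
      refine isCompact_Icc.ultrafilter_le_nhds (𝒰.map fun K => g K j) ?_
      refine le_principal_iff.2
        (show ∀ᶠ K in (𝒰 : Filter MPHyper), g K j ∈ Icc (-B j) (B j) from ?_)
      filter_upwards [hg, hB j] with K h1 h2 using h2 _ h1
    choose x hx hlim using this
    exact ⟨x, tendsto_pi_nhds.2 hlim, hx⟩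
  set A : Set (ℕ → ℝ) := {x | ∀ O, IsOpen O → x ∈ O →
    ∀ᶠ K in (𝒰 : Filter MPHyper), (K.carrier ∩ O).Nonempty} with hA
  have hmemA : ∀ g : MPHyper → ℕ → ℝ, (∀ᶠ K in (𝒰 : Filter MPHyper), g K ∈ K.carrier) →
      ∀ x, Tendsto g 𝒰 (𝓝 x) → x ∈ A := by
    intro g hg x hx O hO hxO
    filter_upwards [hg, hx (hO.mem_nhds hxO)] with K h1 h2 using ⟨g K, h1, h2⟩
  have hne : A.Nonempty := by
    have hg : ∀ᶠ K in (𝒰 : Filter MPHyper), K.nonempty.some ∈ K.carrier :=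
      Eventually.of_forall fun K => K.nonempty.some_mem
    obtain ⟨x, hx, -⟩ := hsel _ hg
    exact ⟨x, hmemA _ hg x hx⟩
  have hclosed : IsClosed A := by
    rw [← closure_subset_iff_isClosed]
    intro x hx O hO hxO
    obtain ⟨y, hyO, hyA⟩ := mem_closure_iff.1 hx O hO hxO
    exact hyA O hO hyO
  have hcompact : IsCompact A := by
    refine (isCompact_univ_pi fun j => isCompact_Icc (a := -B j) (b := B j)).of_isClosed_subset
      hclosed ?_
    intro x hx j _
    by_contra hj
    obtain ⟨K, ⟨y, hy, hyj⟩, hK⟩ := ((hx _ ((isClosed_Icc.isOpen_compl).preimage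
      (continuous_apply j)) hj).and (hB j)).exists
    exact hyj (hK y hy)
  have hconv : MaxPlusConvex A := by
    intro a ha b hb t ht O hO hO'
    obtain ⟨U, V, hU, hV, haU, hbV, hUV⟩ := isOpen_prod_iff.1
      (hO.preimage (continuous_combination t)) a b hO'
    filter_upwards [ha U hU haU, hb V hV hbV]
    rintro K ⟨a', ha', haU'⟩ ⟨b', hb', hbV'⟩
    exact ⟨_, K.convex a' ha' b' hb' t ht, @hUV (a', b') ⟨haU', hbV'⟩⟩
  refine ⟨mk A hne hcompact hconv, le_nhds_of (fun U hU hAU => ?_) ?_⟩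
  · by_contra hcon
    rw [← Ultrafilter.eventually_not] at hcon
    classical
    let g : MPHyper → ℕ → ℝ := fun K =>
      if h : (K.carrier ∩ Uᶜ).Nonempty then h.some else K.nonempty.some
    have hg : ∀ K, g K ∈ K.carrier := by
      intro K
      by_cases h : (K.carrier ∩ Uᶜ).Nonempty
      · simp only [g, h, dif_pos]; exact h.some_mem.1
      · simp only [g, h, dif_neg, not_false_iff]; exact K.nonempty.some_mem
    obtain ⟨x, hx, -⟩ := hsel g (Eventually.of_forall hg)
    have hxU : x ∈ U := hAU (hmemA g (Eventually.of_forall hg) x hx)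
    obtain ⟨K, h1, h2⟩ := (hcon.and (hx (hU.mem_nhds hxU))).exists
    have h : (K.carrier ∩ Uᶜ).Nonempty := not_subset.1 h1
    have : g K ∈ Uᶜ := by simp only [g, h, dif_pos]; exact h.some_mem.2
    exact this h2
  · rintro U hU ⟨x, hxA, hxU⟩
    exact hxA U hU hxU

lemma isClosedEmbedding_coordMap (he : Function.Surjective e) :
    IsClosedEmbedding (coordMap e) := by
  refine .of_continuous_injective_isClosedMap continuous_coordMap (injective_coordMap he) ?_
  refine IsProperMap.isClosedMap ?_
  refine isProperMap_iff_ultrafilter_of_t2.2 ⟨continuous_coordMap, fun 𝒰 y hy => ?_⟩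
  have hbd : ∀ ι, ∃ c, ∀ᶠ K in (𝒰 : Filter MPHyper), ∀ x ∈ K.carrier, testFun ι x ≤ c := by
    intro ι
    obtain ⟨n, rfl⟩ := he ι
    refine ⟨y n + 1, ?_⟩
    filter_upwards [(tendsto_pi_nhds.1 hy n).eventually_lt_const (lt_add_one (y n))] with K hK x hx
    exact (le_maxOn (continuous_testFun (e n)) hx).trans (le_of_lt hK)
  have hB : ∀ j, ∃ c : ℝ, ∀ᶠ K in (𝒰 : Filter MPHyper), ∀ x ∈ K.carrier, x j ∈ Icc (-c) c := by
    intro j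
    obtain ⟨c, hc⟩ := hbd (.inl (0, ∅, some j))
    obtain ⟨d, hd⟩ := hbd (.inr j)
    refine ⟨max c d, ?_⟩
    filter_upwards [hc, hd] with K h1 h2 x hx
    have h3 := h1 x hx
    have h4 := h2 x hx
    simp only [testFun, optCoord, Option.elim_some, excess, Finset.fold_empty, sub_zero] at h3 h4
    exact ⟨by linarith [le_max_right c d], h3.trans (le_max_left c d)⟩
  choose B hB using hB
  exact exists_le_nhds_of_bounded 𝒰 hB

end MPHyper

section Mix

/-- The weight of the first point in `mix`. -/
noncomputable def mixWeight (u : ℝ) : ℝ := min 1 (2 * (1 - u))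

lemma continuous_mixWeight : Continuous mixWeight := by
  unfold mixWeight
  fun_prop

lemma mixWeight_nonneg {u : ℝ} (hu : u ≤ 1) : 0 ≤ mixWeight u :=
  le_min zero_le_one (by linarith)

lemma mixWeight_of_le {u : ℝ} (hu : u ≤ 1 / 2) : mixWeight u = 1 :=
  min_eq_left (by linarith)

lemma mixWeight_of_ge {u : ℝ} (hu : 1 / 2 ≤ u) : mixWeight u = 2 * (1 - u) :=
  min_eq_right (by linarith)

/-- The max-plus combination of `a` and `b` running from `a` at `u = 0` to `b` at `u = 1`. -/
noncomputable def mix (a b : ℕ → ℝ) (u : ℝ) (i : ℕ) : ℝ :=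
  Real.log (max (mixWeight u * Real.exp (a i)) (mixWeight (1 - u) * Real.exp (b i)))

lemma mix_arg_pos (a b : ℝ) (u : ℝ) :
    0 < max (mixWeight u * Real.exp a) (mixWeight (1 - u) * Real.exp b) := by
  rcases le_total u (1 / 2) with h | h
  · exact lt_max_of_lt_left (by rw [mixWeight_of_le h]; positivity)
  · exact lt_max_of_lt_right (by rw [mixWeight_of_le (by linarith)]; positivity)

lemma exp_mix (a b : ℕ → ℝ) (u : ℝ) (i : ℕ) : Real.exp (mix a b u i) =
    max (mixWeight u * Real.exp (a i)) (mixWeight (1 - u) * Real.exp (b i)) :=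
  Real.exp_log (mix_arg_pos _ _ _)

lemma continuous_mix : Continuous fun q : (ℕ → ℝ) × (ℕ → ℝ) × ℝ => mix q.1 q.2.1 q.2.2 := by
  refine continuous_pi fun i => Continuous.log ?_ fun q => (mix_arg_pos _ _ _).ne'
  have := continuous_mixWeight
  fun_prop

lemma mix_symm (a b : ℕ → ℝ) (u : ℝ) : mix a b u = mix b a (1 - u) := by
  funext i
  simp only [mix, sub_sub_cancel]
  rw [max_comm]

lemma mix_zero (a b : ℕ → ℝ) : mix a b 0 = a := by
  funext i
  have h1 : mixWeight 0 = 1 := mixWeight_of_le (by norm_num)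
  have h2 : mixWeight (1 - 0) = 0 := by rw [mixWeight_of_ge (by norm_num)]; norm_num
  rw [mix, h1, h2, one_mul, zero_mul, max_eq_left (Real.exp_pos _).le, Real.log_exp]

lemma apply_mix_le {φ : (ℕ → ℝ) → ℝ} (hφ : MaxPlusQuasiconvex φ) (a b : ℕ → ℝ) {u : ℝ}
    (hu : u ∈ Icc (0 : ℝ) 1) : φ (mix a b u) ≤ max (φ a) (φ b) := by
  have key : ∀ a b : ℕ → ℝ, ∀ u : ℝ, 0 ≤ u → u ≤ 1 / 2 → φ (mix a b u) ≤ max (φ a) (φ b) := by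
    intro a b u h0 h1
    rcases h0.eq_or_lt with rfl | h0
    · rw [mix_zero]; exact le_max_left _ _
    · have : mix a b u = fun i => max (a i) (Real.log (2 * u) + b i) := by
        funext i
        apply Real.exp_injective
        rw [exp_mix, mixWeight_of_le h1, mixWeight_of_ge (by linarith), sub_sub_cancel,
          Real.exp_monotone.map_max, Real.exp_add, Real.exp_log (by linarith), one_mul]
      rw [this]
      exact hφ a b _ (Real.log_nonpos (by linarith) (by linarith))
  rcases le_total u (1 / 2) with h | h
  · exact key a b u hu.1 h
  · rw [mix_symm, max_comm]
    exact key b a (1 - u) (by linarith [hu.2]) (by linarith)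

lemma exists_mixWeight_eq_max {τ u u' θ : ℝ} (hτ : τ ≤ 1) (hu : u ∈ Icc 0 τ) (hu' : u' ∈ Icc 0 τ)
    (hθ1 : θ ≤ 1) : ∃ v ∈ Icc 0 τ,
      mixWeight v = max (mixWeight u) (θ * mixWeight u') ∧
      mixWeight (1 - v) = max (mixWeight (1 - u)) (θ * mixWeight (1 - u')) := by
  obtain ⟨hu0, hu1⟩ := hu
  obtain ⟨hu0', hu1'⟩ := hu'
  have hle : ∀ w, mixWeight w ≤ 1 := fun w => min_le_left _ _
  have hle2 : ∀ w, mixWeight w ≤ 2 * (1 - w) := fun w => min_le_right _ _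
  have hn : 0 ≤ mixWeight u := mixWeight_nonneg (by linarith)
  have hn' : 0 ≤ mixWeight u' := mixWeight_nonneg (by linarith)
  have hm : 0 ≤ mixWeight (1 - u) := mixWeight_nonneg (by linarith)
  have hm' : 0 ≤ mixWeight (1 - u') := mixWeight_nonneg (by linarith)
  have hP1 : θ * mixWeight u' ≤ mixWeight u' := mul_le_of_le_one_left hn' hθ1
  have hQ1 : θ * mixWeight (1 - u') ≤ mixWeight (1 - u') := mul_le_of_le_one_left hm' hθ1
  set P := max (mixWeight u) (θ * mixWeight u') with hP
  set Q := max (mixWeight (1 - u)) (θ * mixWeight (1 - u')) with hQ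
  have hPle : P ≤ 1 := max_le (hle _) (hP1.trans (hle _))
  have hQle : Q ≤ 1 := max_le (hle _) (hQ1.trans (hle _))
  have hP0 : 0 ≤ P := le_max_of_le_left hn
  have hQ0 : 0 ≤ Q := le_max_of_le_left hm
  by_cases h : P = 1
  · refine ⟨Q / 2, ⟨by linarith, ?_⟩, ?_, ?_⟩
    · have : Q ≤ 2 * τ := max_le ((hle2 _).trans (by linarith))
        (hQ1.trans ((hle2 _).trans (by linarith)))
      linarith
    · rw [h, mixWeight_of_le (by linarith)]
    · rw [mixWeight_of_ge (by linarith)]; ring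
  · have hP' : P < 1 := lt_of_le_of_ne hPle h
    have hu2 : 1 / 2 ≤ u := by
      by_contra hcon
      have := mixWeight_of_le (le_of_not_ge hcon)
      have h3 : mixWeight u ≤ P := le_max_left _ _
      linarith
    have hQ : Q = 1 := le_antisymm hQle (by
      have h3 : mixWeight (1 - u) ≤ Q := le_max_left _ _
      rwa [mixWeight_of_le (by linarith)] at h3)
    have hPu : 2 * (1 - u) ≤ P := by
      rw [← mixWeight_of_ge hu2]; exact le_max_left _ _
    refine ⟨1 - P / 2, ⟨by linarith, by linarith⟩, ?_, ?_⟩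
    · rw [mixWeight_of_ge (by linarith)]; ring
    · rw [hQ, mixWeight_of_le (by linarith)]

end Mix

namespace MPHyper

/-- Combinations with arbitrary nonnegative weights stay in `K` up to the total weight. -/
lemma exists_mul_exp_eq_max (K : MPHyper) {a a' : ℕ → ℝ} (ha : a ∈ K.carrier) (ha' : a' ∈ K.carrier)
    {v v' : ℝ} (hv : 0 ≤ v) (hv' : 0 ≤ v') : ∃ c ∈ K.carrier, ∀ i,
      max v v' * Real.exp (c i) = max (v * Real.exp (a i)) (v' * Real.exp (a' i)) := by
  have key : ∀ a ∈ K.carrier, ∀ a' ∈ K.carrier, ∀ v v' : ℝ, 0 ≤ v' → v' ≤ v → ∃ c ∈ K.carrier, ∀ i,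
      max v v' * Real.exp (c i) = max (v * Real.exp (a i)) (v' * Real.exp (a' i)) := by
    intro a ha a' ha' v v' h0 hle
    rcases h0.eq_or_lt with rfl | h0
    · refine ⟨a, ha, fun i => ?_⟩
      rw [max_eq_left hle, zero_mul, max_eq_left (by positivity)]
    · have hv : 0 < v := h0.trans_le hle
      refine ⟨_, K.convex a ha a' ha' (Real.log (v' / v))
        (Real.log_nonpos (by positivity) ((div_le_one hv).2 hle)), fun i => ?_⟩
      rw [max_eq_left hle, Real.exp_monotone.map_max, Real.exp_add, Real.exp_log (by positivity),
        mul_max_of_nonneg _ _ hv.le]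
      congr 1
      field_simp
  rcases le_total v' v with h | h
  · exact key a ha a' ha' v v' hv' h
  · obtain ⟨c, hc, h⟩ := key a' ha' a ha v' v hv h
    exact ⟨c, hc, fun i => by rw [max_comm v, h, max_comm]⟩

lemma continuous_of_range {T Z : Type*} [TopologicalSpace T] [TopologicalSpace Z] [CompactSpace Z]
    {g : T × Z → ℕ → ℝ} (hg : Continuous g) {N : T → MPHyper}
    (hN : ∀ t, (N t).carrier = range fun z => g (t, z)) : Continuous N := by
  refine continuous_of (fun U hU => ?_) fun U hU => ?_
  · simp only [hN, range_subset_iff]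
    rw [isOpen_iff_mem_nhds]
    intro t ht
    have : ∀ᶠ t' in 𝓝 t, ∀ z ∈ (univ : Set Z), g (t', z) ∈ U :=
      isCompact_univ.eventually_forall_of_forall_eventually fun z _ =>
        (hU.preimage hg).mem_nhds (ht z)
    filter_upwards [this] with t' h z using h z (mem_univ z)
  · have : {t | ((N t).carrier ∩ U).Nonempty} = Prod.fst '' (g ⁻¹' U) := by
      ext t
      simp only [mem_ofPred_eq, hN]
      constructor
      · rintro ⟨_, ⟨z, rfl⟩, hz⟩
        exact ⟨(t, z), hz, rfl⟩
      · rintro ⟨⟨t', z⟩, hz, rfl⟩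
        exact ⟨_, ⟨z, rfl⟩, hz⟩
    rw [this]
    exact isOpenMap_fst _ (hU.preimage hg)

/-- Parametrization of the stages of the path from `K` to `L`. -/
noncomputable def mixParam (K L : MPHyper)
    (q : unitInterval × K.carrier × L.carrier × unitInterval) : ℕ → ℝ :=
  mix q.2.1 q.2.2.1 (q.1 * q.2.2.2)

lemma continuous_mixParam (K L : MPHyper) : Continuous (mixParam K L) :=
  continuous_mix.comp (by fun_prop :
    Continuous fun q : unitInterval × K.carrier × L.carrier × unitInterval =>
      ((q.2.1 : ℕ → ℝ), (q.2.2.1 : ℕ → ℝ), (q.1 * q.2.2.2 : ℝ)))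

lemma mem_range_mixParam {K L : MPHyper} {τ : unitInterval} {x : ℕ → ℝ} :
    x ∈ range (fun z => mixParam K L (τ, z)) ↔
      ∃ a ∈ K.carrier, ∃ b ∈ L.carrier, ∃ u ∈ Icc (0 : ℝ) τ, mix a b u = x := by
  constructor
  · rintro ⟨⟨a, b, s⟩, rfl⟩
    exact ⟨a, a.2, b, b.2, τ * s, ⟨mul_nonneg τ.2.1 s.2.1, mul_le_of_le_one_right τ.2.1 s.2.2⟩, rfl⟩
  · rintro ⟨a, ha, b, hb, u, hu, rfl⟩
    rcases τ.2.1.eq_or_lt with h | h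
    · refine ⟨⟨⟨a, ha⟩, ⟨b, hb⟩, 0⟩, ?_⟩
      have : u = 0 := le_antisymm (h ▸ hu.2) hu.1
      simp [mixParam, this]
    · refine ⟨⟨⟨a, ha⟩, ⟨b, hb⟩, ⟨u / τ, div_nonneg hu.1 h.le, (div_le_one h).2 hu.2⟩⟩, ?_⟩
      simp only [mixParam]
      rw [mul_div_cancel₀ _ h.ne']

/-- A path in the hyperspace starting at `K`, ending at the max-plus convex hull of `K ∪ L`. -/
noncomputable def hullPath (K L : MPHyper) (τ : unitInterval) : MPHyper :=
  mk (range fun z => mixParam K L (τ, z))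
    (by
      obtain ⟨a, ha⟩ := K.nonempty
      obtain ⟨b, hb⟩ := L.nonempty
      exact ⟨_, ⟨⟨a, ha⟩, ⟨b, hb⟩, 0⟩, rfl⟩)
    (by
      have := isCompact_iff_compactSpace.1 K.isCompact
      have := isCompact_iff_compactSpace.1 L.isCompact
      exact isCompact_range ((continuous_mixParam K L).comp (by fun_prop)))
    (by
      intro x hx x' hx' t ht
      obtain ⟨a, ha, b, hb, u, hu, rfl⟩ := mem_range_mixParam.1 hx
      obtain ⟨a', ha', b', hb', u', hu', rfl⟩ := mem_range_mixParam.1 hx'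
      have hθ := Real.exp_pos t
      obtain ⟨v, hv, hv1, hv2⟩ := exists_mixWeight_eq_max τ.2.2 hu hu'
        (Real.exp_le_one_iff.2 ht)
      have hτ := τ.2.2
      have hn : 0 ≤ mixWeight u := mixWeight_nonneg (by linarith [hu.2])
      have hn' : 0 ≤ mixWeight u' := mixWeight_nonneg (by linarith [hu'.2])
      have hm : 0 ≤ mixWeight (1 - u) := mixWeight_nonneg (by linarith [hu.1])
      have hm' : 0 ≤ mixWeight (1 - u') := mixWeight_nonneg (by linarith [hu'.1])
      obtain ⟨c, hc, hce⟩ := K.exists_mul_exp_eq_max ha ha' hn (mul_nonneg hθ.le hn')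
      obtain ⟨d, hd, hde⟩ := L.exists_mul_exp_eq_max hb hb' hm (mul_nonneg hθ.le hm')
      refine mem_range_mixParam.2 ⟨c, hc, d, hd, v, hv, funext fun i => Real.exp_injective ?_⟩
      rw [exp_mix, hv1, hv2, hce, hde, Real.exp_monotone.map_max, Real.exp_add, exp_mix, exp_mix,
        mul_max_of_nonneg _ _ hθ.le, mul_assoc, mul_assoc, max_max_max_comm])

lemma mem_hullPath {K L : MPHyper} {τ : unitInterval} {x : ℕ → ℝ} :
    x ∈ (hullPath K L τ).carrier ↔
      ∃ a ∈ K.carrier, ∃ b ∈ L.carrier, ∃ u ∈ Icc (0 : ℝ) τ, mix a b u = x :=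
  mem_range_mixParam

lemma continuous_hullPath (K L : MPHyper) : Continuous (hullPath K L) := by
  have := isCompact_iff_compactSpace.1 K.isCompact
  have := isCompact_iff_compactSpace.1 L.isCompact
  exact continuous_of_range (continuous_mixParam K L) fun _ => rfl

lemma subset_hullPath (K L : MPHyper) (τ : unitInterval) :
    K.carrier ⊆ (hullPath K L τ).carrier := by
  intro a ha
  obtain ⟨b, hb⟩ := L.nonempty
  exact mem_hullPath.2 ⟨a, ha, b, hb, 0, ⟨le_rfl, τ.2.1⟩, mix_zero a b⟩

lemma hullPath_zero (K L : MPHyper) : hullPath K L 0 = K := by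
  refine ext (subset_antisymm (fun x hx => ?_) (subset_hullPath K L 0))
  obtain ⟨a, ha, b, hb, u, hu, rfl⟩ := mem_hullPath.1 hx
  have hu0 : u = 0 := le_antisymm hu.2 hu.1
  rwa [hu0, mix_zero]

lemma hullPath_one_comm (K L : MPHyper) : hullPath K L 1 = hullPath L K 1 := by
  have key : ∀ K L : MPHyper, (hullPath K L 1).carrier ⊆ (hullPath L K 1).carrier := by
    intro K L x hx
    obtain ⟨a, ha, b, hb, u, hu, rfl⟩ := mem_hullPath.1 hx
    refine mem_hullPath.2 ⟨b, hb, a, ha, 1 - u, ?_, (mix_symm a b u).symm⟩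
    have hu1 : u ≤ 1 := hu.2
    exact ⟨by linarith, by simpa using hu.1⟩
  exact ext (subset_antisymm (key K L) (key L K))

lemma maxOn_hullPath_mem {φ : (ℕ → ℝ) → ℝ} (hc : Continuous φ) (hφ : MaxPlusQuasiconvex φ)
    (K L : MPHyper) (τ : unitInterval) :
    maxOn φ (hullPath K L τ) ∈ Icc (maxOn φ K) (max (maxOn φ K) (maxOn φ L)) := by
  refine ⟨maxOn_le hc fun x hx => le_maxOn hc (subset_hullPath K L τ hx),
    maxOn_le hc fun x hx => ?_⟩
  obtain ⟨a, ha, b, hb, u, hu, rfl⟩ := mem_hullPath.1 hx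
  exact (apply_mix_le hφ a b ⟨hu.1, hu.2.trans τ.2.2⟩).trans
    (max_le_max (le_maxOn hc ha) (le_maxOn hc hb))

/-- Any two points lie in a connected set on which maxima of quasiconvex functions stay between
the values at the two points. -/
lemma exists_isPreconnected (K L : MPHyper) : ∃ S : Set MPHyper, IsPreconnected S ∧ K ∈ S ∧ L ∈ S ∧
    ∀ N ∈ S, ∀ φ : (ℕ → ℝ) → ℝ, Continuous φ → MaxPlusQuasiconvex φ →
      maxOn φ N ∈ uIcc (maxOn φ K) (maxOn φ L) := by
  refine ⟨range (hullPath K L) ∪ range (hullPath L K), ?_, Or.inl ⟨0, hullPath_zero K L⟩,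
    Or.inr ⟨0, hullPath_zero L K⟩, ?_⟩
  · exact IsPreconnected.union (hullPath K L 1) ⟨1, rfl⟩ ⟨1, (hullPath_one_comm K L).symm⟩
      (isPreconnected_range (continuous_hullPath K L))
      (isPreconnected_range (continuous_hullPath L K))
  · rintro _ (⟨τ, rfl⟩ | ⟨τ, rfl⟩) φ hc hφ
    · have := maxOn_hullPath_mem hc hφ K L τ
      exact ⟨inf_le_left.trans this.1, this.2⟩
    · have := maxOn_hullPath_mem hc hφ L K τ
      exact ⟨inf_le_right.trans this.1, this.2.trans_eq (max_comm _ _)⟩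

end MPHyper

namespace MPHyper

/-- The translate of `K` by `v`. -/
def translate (K : MPHyper) (v : ℕ → ℝ) : MPHyper :=
  mk ((fun x => x + v) '' K.carrier) (K.nonempty.image _) (K.isCompact.image (by fun_prop)) (by
    rintro _ ⟨a, ha, rfl⟩ _ ⟨b, hb, rfl⟩ t ht
    refine ⟨_, K.convex a ha b hb t ht, funext fun i => ?_⟩
    simp only [Pi.add_apply]
    rw [← add_assoc, max_add_add_right])

lemma carrier_translate (K : MPHyper) (v : ℕ → ℝ) :
    (K.translate v).carrier = (fun x => x + v) '' K.carrier := rfl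

lemma translate_translate (K : MPHyper) (v w : ℕ → ℝ) :
    (K.translate v).translate w = K.translate (v + w) :=
  ext (by simp only [carrier_translate, image_image, add_assoc])

lemma translate_zero (K : MPHyper) : K.translate 0 = K :=
  ext (by simp only [carrier_translate, add_zero, image_id'])

lemma continuous_translate : Continuous fun q : MPHyper × (ℕ → ℝ) => q.1.translate q.2 := by
  have hadd : Continuous fun q : (ℕ → ℝ) × (ℕ → ℝ) => q.1 + q.2 := continuous_add
  refine continuous_of (fun U hU => ?_) fun U hU => ?_
  · rw [isOpen_iff_mem_nhds]
    rintro ⟨K, v⟩ h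
    obtain ⟨A, B, hA, hB, hKA, hvB, hAB⟩ := generalized_tube_lemma K.isCompact
      (isCompact_singleton (x := v)) (hU.preimage hadd) (by
        rintro ⟨x, w⟩ ⟨hx, rfl⟩
        exact h ⟨x, hx, rfl⟩)
    filter_upwards [prod_mem_nhds ((isOpen_subset hA).mem_nhds hKA)
      (hB.mem_nhds (hvB rfl))]
    rintro ⟨L, w⟩ ⟨hL, hw⟩ _ ⟨x, hx, rfl⟩
    exact @hAB (x, w) ⟨hL hx, hw⟩
  · rw [isOpen_iff_mem_nhds]
    rintro ⟨K, v⟩ ⟨_, ⟨x, hx, rfl⟩, hxU⟩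
    obtain ⟨A, B, hA, hB, hxA, hvB, hAB⟩ := isOpen_prod_iff.1 (hU.preimage hadd) x v hxU
    filter_upwards [prod_mem_nhds ((isOpen_inter hA).mem_nhds ⟨x, hx, hxA⟩)
      (hB.mem_nhds hvB)]
    rintro ⟨L, w⟩ ⟨⟨y, hy, hyA⟩, hw⟩
    exact ⟨y + w, ⟨y, hy, rfl⟩, @hAB (y, w) ⟨hyA, hw⟩⟩

/-- The coordinatewise maximum of `K`. -/
noncomputable def top (K : MPHyper) (j : ℕ) : ℝ := maxOn (fun y => y j) K

lemma continuous_top : Continuous top :=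
  continuous_pi fun j => continuous_maxOn (continuous_apply j)

lemma top_translate (K : MPHyper) (v : ℕ → ℝ) : (K.translate v).top = K.top + v := by
  funext j
  have hc : Continuous fun y : ℕ → ℝ => y j := continuous_apply j
  refine le_antisymm (maxOn_le hc ?_) ?_
  · rintro _ ⟨x, hx, rfl⟩
    exact add_le_add_left (le_maxOn hc hx) _
  · obtain ⟨x, hx, hxe⟩ := exists_eq_maxOn hc K
    have := le_maxOn hc (K := K.translate v) ⟨x, hx, rfl⟩
    simp only [Pi.add_apply] at this ⊢
    rwa [hxe] at this

/-- Splitting off the coordinatewise maximum. -/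
noncomputable def splitHomeomorph : MPHyper ≃ₜ {K : MPHyper // K.top = 0} × (ℕ → ℝ) where
  toFun K := (⟨K.translate (-K.top), by rw [top_translate, add_neg_cancel]⟩, K.top)
  invFun q := q.1.1.translate q.2
  left_inv K := by simp only [translate_translate, neg_add_cancel, translate_zero]
  right_inv := by
    rintro ⟨⟨K, hK⟩, v⟩
    have h : (K.translate v).top = v := by rw [top_translate, hK, zero_add]
    simp only [h, translate_translate, add_neg_cancel, translate_zero]
  continuous_toFun := by
    have h : Continuous fun K : MPHyper => K.translate (-K.top) :=
      continuous_translate.comp (continuous_id.prodMk continuous_top.neg)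
    exact (h.subtype_mk _).prodMk continuous_top
  continuous_invFun := continuous_translate.comp
    ((continuous_subtype_val.comp continuous_fst).prodMk continuous_snd)

lemma quasiconvex_apply (j : ℕ) : MaxPlusQuasiconvex fun y => y j := fun _ _ _ ht =>
  max_le_max le_rfl (by linarith)

/-- The hyperspace is homeomorphic to `ℕ → ℝ`. -/
theorem nonempty_homeomorph_pi : Nonempty (MPHyper ≃ₜ (ℕ → ℝ)) := by
  obtain ⟨e, he⟩ := exists_surjective_nat ((ℕ × Finset ℕ × Option ℕ) ⊕ ℕ)
  have : Nonempty {K : MPHyper // K.top = 0} := by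
    have K : MPHyper := mk {0} (singleton_nonempty 0) isCompact_singleton (by
      rintro _ rfl _ rfl t ht
      exact funext fun i => by simpa using ht)
    exact ⟨(splitHomeomorph K).1⟩
  have hclosed : IsClosed {K : MPHyper | K.top = 0} := isClosed_eq continuous_top continuous_const
  obtain ⟨H⟩ := nonempty_prod_homeomorph_pi
    (f := fun K : {K : MPHyper // K.top = 0} => coordMap e K.1)
    ((isClosedEmbedding_coordMap he).comp hclosed.isClosedEmbedding_subtypeVal) (by
      rintro ⟨K, hK⟩ ⟨L, hL⟩
      obtain ⟨S, hS, hKS, hLS, h⟩ := exists_isPreconnected K L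
      have hS0 : ∀ N ∈ S, N.top = 0 := fun N hN => funext fun j => by
        have h1 := h N hN _ (continuous_apply j) (quasiconvex_apply j)
        have hKj : maxOn (fun y => y j) K = 0 := congrFun hK j
        have hLj : maxOn (fun y => y j) L = 0 := congrFun hL j
        rwa [hKj, hLj, uIcc_self] at h1
      refine ⟨Subtype.val ⁻¹' S, ?_, hKS, hLS, fun N hN i =>
        h N.1 hN _ (continuous_testFun _) (quasiconvex_testFun _)⟩
      refine (IsInducing.induced Subtype.val).isPreconnected_image.1 ?_
      rwa [image_preimage_eq_of_subset fun N hN => ⟨⟨N, hS0 N hN⟩, rfl⟩])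
  exact ⟨splitHomeomorph.trans H⟩

end MPHyper

/-- The hyperspace `mpcc(ℝ^ω)` of nonempty compact max-plus convex subsets of `ℕ → ℝ`
is homeomorphic to `ℕ → ℝ` (with the product topology). -/
theorem mpcc_homeomorph_pi :
    letI : TopologicalSpace MPCC := vietoris _
    Nonempty (MPCC ≃ₜ (ℕ → ℝ)) := by
  exact MPHyper.nonempty_homeomorph_pi
end
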